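/- Let q ≠ 0 and let M and N be finite dimensional H_n(q)-modules each of which is a direct sum of indecomposable modules that are direct summands of modules induced from 1-dimensional representations of parabolic subalgebras. Then dim Hom_{H_n(q)}(N, M) = dim Hom_{H_n(q)}(M, N). -/

import Mathlib

noncomputable section
open Classical

variable (k : Type) [Field k] (N : ℕ)

/-- The basic transposition `τ_i = (i, i+1)` in `S_{N+1}`. -/
def tau (i : Fin N) : Equiv.Perm (Fin (N + 1)) := Equiv.swap i.castSucc i.succ

/-- The Coxeter length of a permutation. -/
def len (σ : Equiv.Perm (Fin (N + 1))) : ℕ :=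
  sInf {m | ∃ l : List (Fin N), l.length = m ∧ (l.map (tau N)).prod = σ}

/-- The Young subgroup `S_λ` generated by the basic transpositions indexed by `B`. -/
def youngSubgroup (B : Set (Fin N)) : Subgroup (Equiv.Perm (Fin (N + 1))) :=
  Subgroup.closure (tau N '' B)

/-- `σ` is a distinguished (minimal length) left coset representative of `σ S_λ`. -/
def IsDistL (B : Set (Fin N)) (σ : Equiv.Perm (Fin (N + 1))) : Prop :=
  ∀ s ∈ youngSubgroup N B, len N σ ≤ len N (σ * s)

/-- The set `D_λ` of distinguished left coset representatives. -/
def Dset (B : Set (Fin N)) : Type := {σ : Equiv.Perm (Fin (N + 1)) // IsDistL N B σ}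

/-- `χ : Fin N → k` restricted to `B` defines a one-dimensional representation of
the parabolic subalgebra `H_λ`: the values satisfy the quadratic relation and are
compatible with the braid relations. -/
def IsOneDimRep (q : k) (B : Set (Fin N)) (χ : Fin N → k) : Prop :=
  (∀ i ∈ B, (χ i - q) * (χ i + 1) = 0) ∧
  (∀ i ∈ B, ∀ j ∈ B, ((i : ℕ) + 1 = j ∨ (j : ℕ) + 1 = i) →
    χ i * χ j * χ i = χ j * χ i * χ j)

/-- The underlying vector space of the induced module `H_n(q) ⊗_{H_λ} k(χ)`,
with standard basis `{T_σ c : σ ∈ D_λ}` indexed by distinguished coset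
representatives. -/
def IndM (B : Set (Fin N)) : Type := Dset N B →₀ k

instance (B : Set (Fin N)) : AddCommGroup (IndM k N B) :=
  inferInstanceAs (AddCommGroup (Dset N B →₀ k))

instance (B : Set (Fin N)) : Module k (IndM k N B) :=
  inferInstanceAs (Module k (Dset N B →₀ k))

/-- The action of the generator `T_i` on the standard basis vector `v_σ` of the
induced module `H_n(q) ⊗_{H_λ} k(χ)`:
`T_i v_σ = v_{τ_iσ}` if `σ ∈ A_i(λ)`;
`T_i v_σ = (q-1) v_σ + q v_{τ_iσ}` if `τ_i σ ∈ A_i(λ)`, `τ_iσ < σ`;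
`T_i v_σ = χ_σ(T_i) v_σ = χ(T_j) v_σ` with `τ_j = σ⁻¹τ_iσ ∈ B_λ` if `σ ∈ B_i(λ)`. -/
def indAct (q : k) (B : Set (Fin N)) (χ : Fin N → k) (i : Fin N) (σ : Dset N B) :
    IndM k N B :=
  if h : ∃ j, j ∈ B ∧ σ.1⁻¹ * tau N i * σ.1 = tau N j then
    χ h.choose • Finsupp.single σ 1
  else if hD : IsDistL N B (tau N i * σ.1) then
    (if len N σ.1 < len N (tau N i * σ.1) then
      Finsupp.single ⟨tau N i * σ.1, hD⟩ 1
    else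
      (q - 1) • Finsupp.single σ 1 + q • Finsupp.single ⟨tau N i * σ.1, hD⟩ 1)
  else 0

/-- The operator by which the generator `T_i` acts on the induced module
`H_n(q) ⊗_{H_λ} k(χ)`. -/
def indT (q : k) (B : Set (Fin N)) (χ : Fin N → k) (i : Fin N) :
    Module.End k (IndM k N B) :=
  (Finsupp.lift (IndM k N B) k (Dset N B)) (indAct k N q B χ i)


/-- A family of operators `T i` on `M` makes `M` a left module over the Hecke
algebra `H_{N+1}(q)`. -/
def IsHeckeRep {M : Type} [AddCommGroup M] [Module k M] (q : k)
    (T : Fin N → Module.End k M) : Prop :=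
  (∀ i j : Fin N, ((i : ℕ) + 1 = j ∨ (j : ℕ) + 1 = i) →
      T i * T j * T i = T j * T i * T j) ∧
  (∀ i j : Fin N, ((i : ℕ) + 1 < j ∨ (j : ℕ) + 1 < i) → T i * T j = T j * T i) ∧
  (∀ i : Fin N, (T i - q • 1) * (T i + 1) = 0)

/-- The space of `H_n(q)`-module homomorphisms between two Hecke modules,
i.e. of linear maps intertwining the two actions. -/
def interTw {M M' : Type} [AddCommGroup M] [Module k M] [AddCommGroup M'] [Module k M']
    (T : Fin N → Module.End k M) (S : Fin N → Module.End k M') :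
    Submodule k (M →ₗ[k] M') where
  carrier := {φ | ∀ i : Fin N, φ ∘ₗ T i = S i ∘ₗ φ}
  add_mem' := by
    intro a b ha hb i
    rw [LinearMap.add_comp, LinearMap.comp_add, ha i, hb i]
  zero_mem' := by
    intro i
    rw [LinearMap.zero_comp, LinearMap.comp_zero]
  smul_mem' := by
    intro c a ha i
    rw [LinearMap.smul_comp, LinearMap.comp_smul, ha i]

/-- The diagonal Hecke action on a finite direct sum of induced modules. -/
def piIndT (q : k) {r : ℕ} (Bs : Fin r → Set (Fin N)) (χs : Fin r → (Fin N → k))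
    (i : Fin N) : Module.End k ((t : Fin r) → IndM k N (Bs t)) :=
  LinearMap.pi fun t => (indT k N q (Bs t) (χs t) i) ∘ₗ LinearMap.proj t

/-- `M` (with Hecke action `T`) has only indecomposable direct summands with
one-dimensional sources: equivalently, `M` is a direct summand, as a Hecke
module, of a finite direct sum of modules induced from one-dimensional
representations of parabolic subalgebras. -/
def HasOneDimSources {M : Type} [AddCommGroup M] [Module k M] (q : k)
    (T : Fin N → Module.End k M) : Prop :=
  ∃ (r : ℕ) (Bs : Fin r → Set (Fin N)) (χs : Fin r → (Fin N → k)),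
    (∀ t, IsOneDimRep k N q (Bs t) (χs t)) ∧
    ∃ (ι : M →ₗ[k] ((t : Fin r) → IndM k N (Bs t)))
      (π : ((t : Fin r) → IndM k N (Bs t)) →ₗ[k] M),
      (∀ i : Fin N, ι ∘ₗ T i = piIndT k N q Bs χs i ∘ₗ ι) ∧
      (∀ i : Fin N, π ∘ₗ piIndT k N q Bs χs i = T i ∘ₗ π) ∧
      π ∘ₗ ι = LinearMap.id


section Comb

variable {N}

lemma tau_apply (i : Fin N) (x : Fin (N + 1)) :
    tau N i x = if x = i.castSucc then i.succ else if x = i.succ then i.castSucc else x := by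
  simp [tau, Equiv.swap_apply_def]

lemma tau_inv (i : Fin N) : (tau N i)⁻¹ = tau N i := by simp [tau]

lemma tau_tau (i : Fin N) (x : Fin (N + 1)) : tau N i (tau N i x) = x := by simp [tau]

lemma tau_mul_self (i : Fin N) : tau N i * tau N i = 1 := by simp [tau]

lemma tau_castSucc (i : Fin N) : tau N i i.castSucc = i.succ := by simp [tau]

lemma tau_succ (i : Fin N) : tau N i i.succ = i.castSucc := by simp [tau]

lemma tau_lt_tau (i : Fin N) (x y : Fin (N + 1)) :
    tau N i x < tau N i y ↔
      (x < y ∧ ¬ (x = i.castSucc ∧ y = i.succ)) ∨ (x = i.succ ∧ y = i.castSucc) := by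
  rw [tau_apply, tau_apply]
  split_ifs with h1 h2 h3 h4 h5 h6 <;> simp only [Fin.ext_iff, Fin.lt_def, Fin.val_castSucc, Fin.val_succ] at * <;> omega

lemma castSucc_lt_succ' (i : Fin N) : i.castSucc < i.succ := by simp

lemma castSucc_ne_succ' (i : Fin N) : i.castSucc ≠ i.succ := (castSucc_lt_succ' i).ne

/-- The inversion set. -/
def InvS (v : Equiv.Perm (Fin (N + 1))) : Finset (Fin (N + 1) × Fin (N + 1)) :=
  Finset.univ.filter fun p => p.1 < p.2 ∧ v⁻¹ p.2 < v⁻¹ p.1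

lemma mem_InvS (v : Equiv.Perm (Fin (N + 1))) (x y : Fin (N + 1)) :
    (v x, v y) ∈ InvS v ↔ v x < v y ∧ y < x := by
  simp [InvS]

lemma InvS_one : InvS (1 : Equiv.Perm (Fin (N + 1))) = ∅ := by
  ext ⟨a, b⟩
  simp [InvS]
  intro h; exact h.le

lemma InvS_mul_tau (v : Equiv.Perm (Fin (N + 1))) (i : Fin N) (h : v i.castSucc < v i.succ) :
    InvS (v * tau N i) = insert (v i.castSucc, v i.succ) (InvS v) := by
  ext ⟨a, b⟩
  obtain ⟨x, rfl⟩ := v.surjective a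
  obtain ⟨y, rfl⟩ := v.surjective b
  rw [Finset.mem_insert, mem_InvS]
  have e1 : v x = (v * tau N i) (tau N i x) := by simp [tau_tau]
  have e2 : v y = (v * tau N i) (tau N i y) := by simp [tau_tau]
  have : (v x, v y) ∈ InvS (v * tau N i) ↔ v x < v y ∧ tau N i y < tau N i x := by
    conv_lhs => rw [e1, e2]
    rw [mem_InvS]; simp [tau_tau]
  rw [this, tau_lt_tau, Prod.mk.injEq, v.injective.eq_iff, v.injective.eq_iff]
  constructor
  · rintro ⟨h1, ⟨h2, h3⟩ | ⟨rfl, rfl⟩⟩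
    · right; exact ⟨h1, h2⟩
    · left; exact ⟨rfl, rfl⟩
  · rintro (⟨rfl, rfl⟩ | ⟨h1, h2⟩)
    · exact ⟨h, Or.inr ⟨rfl, rfl⟩⟩
    · refine ⟨h1, Or.inl ⟨h2, ?_⟩⟩
      rintro ⟨rfl, rfl⟩
      exact absurd h1 h.not_gt

lemma not_mem_InvS (v : Equiv.Perm (Fin (N + 1))) (i : Fin N) :
    (v i.castSucc, v i.succ) ∉ InvS v := by
  rw [mem_InvS]
  rintro ⟨_, h⟩
  exact absurd h (castSucc_lt_succ' i).not_gt

lemma mul_tau_lt (v : Equiv.Perm (Fin (N + 1))) (i : Fin N) :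
    (v * tau N i) i.castSucc < (v * tau N i) i.succ ↔ v i.succ < v i.castSucc := by
  simp [tau_castSucc, tau_succ]

lemma eq_one_of_lt (v : Equiv.Perm (Fin (N + 1)))
    (h : ∀ i : Fin N, v i.castSucc < v i.succ) : v = 1 := by
  have hm : StrictMono v := Fin.strictMono_iff_lt_succ.2 h
  have := (Equiv.Perm.monotone_iff v).1 hm.monotone
  simpa using this

lemma lt_or_gt_of_tau (v : Equiv.Perm (Fin (N + 1))) (i : Fin N) :
    v i.castSucc < v i.succ ∨ v i.succ < v i.castSucc :=
  lt_or_gt_of_ne (fun h => castSucc_ne_succ' i (v.injective h))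

/-- Induction from the identity, multiplying on the right by ascents. -/
lemma perm_induction {P : Equiv.Perm (Fin (N + 1)) → Prop} (h1 : P 1)
    (hs : ∀ v (i : Fin N), v i.castSucc < v i.succ → P v → P (v * tau N i)) : ∀ v, P v := by
  intro v
  induction hn : (InvS v).card using Nat.strong_induction_on generalizing v with
  | _ n ih =>
    by_cases hv : v = 1
    · rw [hv]; exact h1
    · obtain ⟨i, hi⟩ : ∃ i : Fin N, v i.succ < v i.castSucc := by
        by_contra hcon
        push Not at hcon
        exact hv (eq_one_of_lt v fun i => (lt_or_gt_of_tau v i).resolve_right (hcon i).not_gt)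
      have h2 := (mul_tau_lt v i).2 hi
      have h3 := hs (v * tau N i) i h2
      rw [mul_assoc, tau_mul_self, mul_one] at h3
      apply h3
      have h4 := InvS_mul_tau _ i h2
      rw [mul_assoc, tau_mul_self, mul_one] at h4
      have h5 : (InvS v).card = (InvS (v * tau N i)).card + 1 := by
        rw [h4, Finset.card_insert_of_notMem (not_mem_InvS _ i)]
      exact ih _ (by omega) _ rfl

lemma perm_induction_left {P : Equiv.Perm (Fin (N + 1)) → Prop} (h1 : P 1)
    (hs : ∀ v (i : Fin N), v⁻¹ i.castSucc < v⁻¹ i.succ → P v → P (tau N i * v)) : ∀ v, P v := by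
  intro v
  have := perm_induction (P := fun v => P v⁻¹) (by simpa using h1)
    (fun v i hi hv => by
      have := hs v⁻¹ i (by simpa using hi) hv
      rwa [mul_inv_rev, tau_inv]) v⁻¹
  simpa using this

end Comb

section Reg

variable {N} {R : Type} [CommRing R]

/-- Short name for the symmetric group. -/
abbrev Wp (N : ℕ) := Equiv.Perm (Fin (N + 1))

/-- Intertwining maps. -/
def Itw {X Y : Type} [AddCommGroup X] [Module R X] [AddCommGroup Y] [Module R Y]
    (T : Fin N → Module.End R X) (S : Fin N → Module.End R Y) (φ : X →ₗ[R] Y) : Prop :=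
  ∀ i, φ ∘ₗ T i = S i ∘ₗ φ

section ItwBasics
variable {X Y Z : Type} [AddCommGroup X] [Module R X] [AddCommGroup Y] [Module R Y]
    [AddCommGroup Z] [Module R Z]
    {T : Fin N → Module.End R X} {S : Fin N → Module.End R Y} {U : Fin N → Module.End R Z}

lemma Itw.apply {φ : X →ₗ[R] Y} (h : Itw T S φ) (i : Fin N) (x : X) : φ (T i x) = S i (φ x) :=
  LinearMap.congr_fun (h i) x

lemma Itw.comp {φ : X →ₗ[R] Y} {ψ : Y →ₗ[R] Z} (h : Itw T S φ) (h' : Itw S U ψ) :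
    Itw T U (ψ ∘ₗ φ) := by
  intro i
  ext x
  simp [h.apply, h'.apply]

lemma Itw.mul {φ ψ : Module.End R X} (h : Itw T T φ) (h' : Itw T T ψ) : Itw T T (φ * ψ) :=
  h'.comp h

lemma Itw.add {φ ψ : X →ₗ[R] Y} (h : Itw T S φ) (h' : Itw T S ψ) : Itw T S (φ + ψ) := by
  intro i; ext x; simp [h.apply, h'.apply]

lemma Itw.sub {φ ψ : X →ₗ[R] Y} (h : Itw T S φ) (h' : Itw T S ψ) : Itw T S (φ - ψ) := by
  intro i; ext x; simp [h.apply, h'.apply]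

lemma Itw.smul {φ : X →ₗ[R] Y} (h : Itw T S φ) (r : R) : Itw T S (r • φ) := by
  intro i; ext x; simp [h.apply]

lemma Itw.zero : Itw T S (0 : X →ₗ[R] Y) := by
  intro i; ext x; simp

lemma Itw.one : Itw T T (1 : Module.End R X) := by
  intro i; ext x; simp

lemma Itw.sum {ι : Type} (s : Finset ι) {φ : ι → X →ₗ[R] Y} (h : ∀ a ∈ s, Itw T S (φ a)) :
    Itw T S (∑ a ∈ s, φ a) := by
  induction s using Finset.induction_on with
  | empty => simpa using Itw.zero
  | insert a s ha ih =>
    rw [Finset.sum_insert ha]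
    exact (h a (by simp)).add (ih fun b hb => h b (by simp [hb]))

end ItwBasics

/-- Left regular operators. -/
def LF (q : R) (i : Fin N) : Module.End R (Wp N → R) where
  toFun x v := if v i.castSucc < v i.succ then q * x (v * tau N i)
    else (q - 1) * x v + x (v * tau N i)
  map_add' x y := by ext v; simp only [Pi.add_apply]; split_ifs <;> ring
  map_smul' r x := by ext v; simp only [Pi.smul_apply, smul_eq_mul, RingHom.id_apply]; split_ifs <;> ring

/-- Right regular operators. -/
def RF (q : R) (i : Fin N) : Module.End R (Wp N → R) where
  toFun x v := if v⁻¹ i.castSucc < v⁻¹ i.succ then q * x (tau N i * v)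
    else (q - 1) * x v + x (tau N i * v)
  map_add' x y := by ext v; simp only [Pi.add_apply]; split_ifs <;> ring
  map_smul' r x := by ext v; simp only [Pi.smul_apply, smul_eq_mul, RingHom.id_apply]; split_ifs <;> ring

lemma LF_apply (q : R) (i : Fin N) (x : Wp N → R) (v : Wp N) :
    LF q i x v = if v i.castSucc < v i.succ then q * x (v * tau N i)
    else (q - 1) * x v + x (v * tau N i) := rfl

lemma RF_apply (q : R) (i : Fin N) (x : Wp N → R) (v : Wp N) :
    RF q i x v = if v⁻¹ i.castSucc < v⁻¹ i.succ then q * x (tau N i * v)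
    else (q - 1) * x v + x (tau N i * v) := rfl

lemma tau_ne_one (i : Fin N) : tau N i ≠ 1 := by
  intro h
  have := tau_castSucc i
  rw [h] at this
  exact castSucc_ne_succ' i this

lemma LF_single (q : R) (i : Fin N) (v : Wp N) (h : v i.castSucc < v i.succ) :
    LF q i (Pi.single v 1) = Pi.single (v * tau N i) 1 := by
  ext w
  rw [LF_apply]
  by_cases h1 : w = v
  · subst h1
    simp [h, Pi.single_apply, tau_ne_one]
  · by_cases h2 : w = v * tau N i
    · subst h2
      rw [if_neg]
      · simp [Pi.single_apply, mul_assoc, tau_mul_self, tau_ne_one]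
      · rw [mul_tau_lt]; exact h.not_gt
    · have h3 : w * tau N i ≠ v := by
        rintro rfl; apply h2; rw [mul_assoc, tau_mul_self, mul_one]
      simp [Pi.single_apply, h1, h2, h3]

lemma tau_mul_inv_lt (v : Wp N) (i : Fin N) :
    (tau N i * v)⁻¹ i.castSucc < (tau N i * v)⁻¹ i.succ ↔ v⁻¹ i.succ < v⁻¹ i.castSucc := by
  rw [mul_inv_rev, tau_inv, mul_tau_lt]

lemma RF_single (q : R) (i : Fin N) (v : Wp N) (h : v⁻¹ i.castSucc < v⁻¹ i.succ) :
    RF q i (Pi.single v 1) = Pi.single (tau N i * v) 1 := by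
  ext w
  rw [RF_apply]
  by_cases h1 : w = v
  · subst h1
    rw [if_pos h]
    simp [tau_ne_one]
  · by_cases h2 : w = tau N i * v
    · subst h2
      rw [if_neg]
      · simp [Pi.single_apply, ← mul_assoc, tau_mul_self, tau_ne_one]
      · rw [tau_mul_inv_lt]; exact h.not_gt
    · have h3 : tau N i * w ≠ v := by
        rintro rfl; apply h2; rw [← mul_assoc, tau_mul_self, one_mul]
      simp [Pi.single_apply, h1, h2, h3]

/-- if `τ_j` flips the relative order of `v i, v (i+1)` then `τ_j v = v τ_i`. -/
lemma tau_flip (v : Wp N) (i j : Fin N)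
    (h : ¬ (tau N j (v i.castSucc) < tau N j (v i.succ) ↔ v i.castSucc < v i.succ)) :
    (v i.castSucc = j.castSucc ∧ v i.succ = j.succ) ∨
    (v i.castSucc = j.succ ∧ v i.succ = j.castSucc) := by
  rw [tau_lt_tau] at h
  by_contra hc
  apply h
  push Not at hc
  constructor
  · rintro (⟨h1, _⟩ | ⟨h1, h2⟩)
    · exact h1
    · exact absurd h2 (hc.2 h1)
  · intro h1
    left
    exact ⟨h1, fun h2 => hc.1 h2.1 h2.2⟩

lemma tau_mul_eq_of (v : Wp N) (i j : Fin N)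
    (h : (v i.castSucc = j.castSucc ∧ v i.succ = j.succ) ∨
    (v i.castSucc = j.succ ∧ v i.succ = j.castSucc)) : tau N j * v = v * tau N i := by
  have : v * tau N i * v⁻¹ = tau N j := by
    unfold tau
    rw [← Equiv.swap_apply_apply]
    rcases h with ⟨h1, h2⟩ | ⟨h1, h2⟩
    · rw [h1, h2]
    · rw [h1, h2, Equiv.swap_comm]
  rw [← this]; simp [mul_assoc]

lemma LF_RF_comm (q : R) (i j : Fin N) (x : Wp N → R) :
    LF q i (RF q j x) = RF q j (LF q i x) := by
  ext v
  simp only [LF_apply, RF_apply, mul_inv_rev, tau_inv, Equiv.Perm.mul_apply, tau_castSucc, tau_succ,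
    mul_assoc]
  by_cases hcase : (v i.castSucc = j.castSucc ∧ v i.succ = j.succ) ∨
    (v i.castSucc = j.succ ∧ v i.succ = j.castSucc)
  · have e := tau_mul_eq_of v i j hcase
    have e2 : v = tau N j * (v * tau N i) := by
      rw [← e, ← mul_assoc, tau_mul_self, one_mul]
    have hlt := castSucc_lt_succ' i
    have hlt' := castSucc_lt_succ' j
    rcases hcase with ⟨h1, h2⟩ | ⟨h1, h2⟩
    · have h3 : v⁻¹ j.castSucc = i.castSucc := by rw [← h1]; simp
      have h4 : v⁻¹ j.succ = i.succ := by rw [← h2]; simp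
      simp only [h1, h2, h3, h4, tau_castSucc, tau_succ, hlt, hlt', hlt.not_gt, hlt'.not_gt,
        if_true, if_false, ← e2, e]
    · have h3 : v⁻¹ j.succ = i.castSucc := by rw [← h1]; simp
      have h4 : v⁻¹ j.castSucc = i.succ := by rw [← h2]; simp
      simp only [h1, h2, h3, h4, tau_castSucc, tau_succ, hlt, hlt', hlt.not_gt, hlt'.not_gt,
        if_true, if_false, ← e2, e]
  · have a1 : tau N j (v i.castSucc) < tau N j (v i.succ) ↔ v i.castSucc < v i.succ := by
      by_contra hc; exact hcase (tau_flip v i j hc)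
    have a2 : tau N i (v⁻¹ j.castSucc) < tau N i (v⁻¹ j.succ) ↔ v⁻¹ j.castSucc < v⁻¹ j.succ := by
      by_contra hc
      apply hcase
      rcases tau_flip v⁻¹ j i hc with ⟨h1, h2⟩ | ⟨h1, h2⟩
      · left
        rw [← h1, ← h2]; simp
      · right
        rw [← h1, ← h2]; simp
    simp only [a1, a2]
    split_ifs <;> ring

/-- An intertwiner out of the regular module is determined by the image of the generator. -/
lemma reg_ext {Y : Type} [AddCommGroup Y] [Module R Y] {S : Fin N → Module.End R Y} {q : R}
    {α β : (Wp N → R) →ₗ[R] Y} (hα : Itw (LF q) S α) (hβ : Itw (LF q) S β)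
    (h : α (Pi.single 1 1) = β (Pi.single 1 1)) : α = β := by
  have key : ∀ v : Wp N, α (Pi.single v 1) = β (Pi.single v 1) := by
    apply perm_induction
    · exact h
    · intro v i hv ih
      rw [← LF_single q i v hv, hα.apply, hβ.apply, ih]
  apply LinearMap.pi_ext'
  intro v
  ext
  simpa using key v

/-- The right regular algebra. -/
def RAlg (N : ℕ) (q : R) : Subalgebra R (Module.End R (Wp N → R)) :=
  Algebra.adjoin R (Set.range (RF q))

lemma RAlg_itw (q : R) {ρ : Module.End R (Wp N → R)} (h : ρ ∈ RAlg N q) : Itw (LF q) (LF q) ρ := by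
  induction h using Algebra.adjoin_induction with
  | mem x hx =>
    obtain ⟨j, rfl⟩ := hx
    intro i
    ext1
    ext1
    simp [LF_RF_comm]
  | algebraMap r => 
    rw [Algebra.algebraMap_eq_smul_one]; exact Itw.one.smul r
  | add x y _ _ hx hy => exact hx.add hy
  | mul x y _ _ hx hy => exact hx.mul hy

lemma exists_RAlg_single (q : R) (v : Wp N) :
    ∃ ρ ∈ RAlg N q, ρ (Pi.single 1 1) = Pi.single v 1 := by
  revert v
  apply perm_induction_left
  · exact ⟨1, one_mem _, rfl⟩
  · rintro v i hi ⟨ρ, h1, h2⟩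
    refine ⟨RF q i * ρ, mul_mem (Algebra.subset_adjoin ⟨i, rfl⟩) h1, ?_⟩
    rw [Module.End.mul_apply, h2, RF_single q i v hi]

lemma exists_RAlg (q : R) (y : Wp N → R) :
    ∃ ρ ∈ RAlg N q, ρ (Pi.single 1 1) = y := by
  choose ρ h1 h2 using exists_RAlg_single (N := N) q
  refine ⟨∑ v, y v • ρ v, sum_mem fun v _ => Subalgebra.smul_mem _ (h1 v) _, ?_⟩
  simp only [LinearMap.sum_apply, LinearMap.smul_apply, h2]
  ext w
  simp [Pi.single_apply]

lemma mem_RAlg_of_itw (q : R) {ρ : Module.End R (Wp N → R)} (h : Itw (LF q) (LF q) ρ) :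
    ρ ∈ RAlg N q := by
  obtain ⟨ρ', h1, h2⟩ := exists_RAlg q (ρ (Pi.single 1 1))
  rw [reg_ext h (RAlg_itw q h1) h2.symm]
  exact h1

/-- The trace on endomorphisms of the regular module. -/
def tF : Module.End R (Wp N → R) →ₗ[R] R where
  toFun α := α (Pi.single 1 1) 1
  map_add' _ _ := rfl
  map_smul' _ _ := rfl

lemma tF_apply (α : Module.End R (Wp N → R)) : tF α = α (Pi.single 1 1) 1 := rfl

lemma tF_comm (q : R) {α β : Module.End R (Wp N → R)} (hα : Itw (LF q) (LF q) α)
    (hβ : Itw (LF q) (LF q) β) : tF (α * β) = tF (β * α) := by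
  have hβ' := mem_RAlg_of_itw q hβ
  clear hβ
  revert α
  induction hβ' using Algebra.adjoin_induction with
  | mem x hx =>
    intro α hα
    obtain ⟨j, rfl⟩ := hx
    rw [tF_apply, tF_apply, Module.End.mul_apply, Module.End.mul_apply,
      RF_single q j 1 (by simp), mul_one, ← one_mul (tau N j), ← LF_single q j 1 (by simp),
      hα.apply, LF_apply, RF_apply]
    simp
  | algebraMap r =>
    intro α hα
    rw [Algebra.algebraMap_eq_smul_one]; simp
  | add x y _ _ hx hy => 
    intro α hα
    rw [mul_add, add_mul, map_add, map_add, hx hα, hy hα]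
  | mul x y hx' hy' hx hy => 
    intro α hα
    rw [← mul_assoc, hy (hα.mul (RAlg_itw q hx')), ← mul_assoc, hx ((RAlg_itw q hy').mul hα),
      mul_assoc]

lemma tF_nondeg (q : R) (hq : IsUnit q) {α : Module.End R (Wp N → R)} (hα : Itw (LF q) (LF q) α)
    (h : ∀ β, Itw (LF q) (LF q) β → tF (α * β) = 0) : α = 0 := by
  apply reg_ext hα Itw.zero
  have key : ∀ v : Wp N, ∃ ρ ∈ RAlg N q, ∃ r : R, IsUnit r ∧ ∀ z, ρ z 1 = r * z v := by
    apply perm_induction_left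
    · exact ⟨1, one_mem _, 1, isUnit_one, by simp⟩
    · rintro v i hi ⟨ρ, h1, r, h2, h3⟩
      refine ⟨ρ * RF q i, mul_mem h1 (Algebra.subset_adjoin ⟨i, rfl⟩), r * q, h2.mul hq, ?_⟩
      intro z
      rw [Module.End.mul_apply, h3, RF_apply, if_pos hi, mul_assoc]
  ext v
  obtain ⟨ρ, h1, r, h2, h3⟩ := key v
  have := h ρ (RAlg_itw q h1)
  rw [tF_comm q hα (RAlg_itw q h1), tF_apply, Module.End.mul_apply, h3] at this
  simpa using (h2.mul_right_eq_zero).1 this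

end Reg

section Words

variable {N} {R : Type} [CommRing R] {A : Type} [LinearOrder A] [Fintype A]

/-- Words in the alphabet `A`. -/
abbrev Wd (N : ℕ) (A : Type) := Fin (N + 1) → A

lemma comp_tau_comp_tau (u : Wd N A) (i : Fin N) : (u ∘ tau N i) ∘ tau N i = u := by
  ext x; simp [tau_tau]

lemma comp_tau_eq (u : Wd N A) (i : Fin N) (h : u i.castSucc = u i.succ) : u ∘ tau N i = u := by
  ext x
  simp only [Function.comp, tau_apply]
  split_ifs with h1 h2
  · rw [h1, h]
  · rw [h2, h]
  · rfl

lemma comp_mul' (u : Wd N A) (v w : Wp N) : u ∘ (v * w : Wp N) = (u ∘ v) ∘ w := rfl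

lemma LF_single_gt (q : R) (i : Fin N) (v : Wp N) (h : v i.succ < v i.castSucc) :
    LF q i (Pi.single v 1) = (q - 1) • Pi.single v 1 + q • Pi.single (v * tau N i) 1 := by
  ext w
  rw [LF_apply]
  by_cases h1 : w = v
  · subst h1
    rw [if_neg h.not_gt]
    simp [tau_ne_one]
  · by_cases h2 : w = v * tau N i
    · subst h2
      rw [if_pos]
      · simp [mul_assoc, tau_mul_self, tau_ne_one]
      · rw [mul_tau_lt]; exact h
    · have h3 : w * tau N i ≠ v := by
        rintro rfl; apply h2; rw [mul_assoc, tau_mul_self, mul_one]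
      simp [h1, h2, h3]

/-- The Hecke generators on the space of words. -/
def TX (q : R) (c : A → R) (i : Fin N) : Module.End R (Wd N A → R) where
  toFun x u := if u i.castSucc = u i.succ then c (u i.castSucc) * x u else
    if u i.castSucc < u i.succ then q * x (u ∘ tau N i)
    else (q - 1) * x u + x (u ∘ tau N i)
  map_add' x y := by ext v; simp only [Pi.add_apply]; split_ifs <;> ring
  map_smul' r x := by ext v; simp only [Pi.smul_apply, smul_eq_mul, RingHom.id_apply]; split_ifs <;> ring

lemma TX_apply (q : R) (c : A → R) (i : Fin N) (x : Wd N A → R) (u : Wd N A) :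
    TX q c i x u = if u i.castSucc = u i.succ then c (u i.castSucc) * x u else
    if u i.castSucc < u i.succ then q * x (u ∘ tau N i)
    else (q - 1) * x u + x (u ∘ tau N i) := rfl

lemma comp_tau_ne (u : Wd N A) (i : Fin N) (h : u i.castSucc ≠ u i.succ) : u ∘ tau N i ≠ u := by
  intro h1
  have := congrFun h1 i.castSucc
  simp [tau_castSucc] at this
  exact h this.symm

lemma TX_single_eq (q : R) (c : A → R) (i : Fin N) (u : Wd N A) (h : u i.castSucc = u i.succ) :
    TX q c i (Pi.single u 1) = c (u i.castSucc) • Pi.single u 1 := by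
  ext w
  rw [TX_apply]
  by_cases h1 : w = u
  · subst h1
    rw [if_pos h]; simp
  · have h3 : w ∘ tau N i ≠ u := by
      intro h4
      have h5 := comp_tau_comp_tau w i
      rw [h4, comp_tau_eq u i h] at h5
      exact h1 h5.symm
    simp [h1, h3]

lemma TX_single_lt (q : R) (c : A → R) (i : Fin N) (u : Wd N A) (h : u i.castSucc < u i.succ) :
    TX q c i (Pi.single u 1) = Pi.single (u ∘ tau N i) 1 := by
  ext w
  rw [TX_apply]
  by_cases h1 : w = u
  · subst h1
    rw [if_neg h.ne, if_pos h, Pi.single_eq_of_ne (comp_tau_ne w i h.ne),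
      Pi.single_eq_of_ne (comp_tau_ne w i h.ne).symm, mul_zero]
  · by_cases h2 : w = u ∘ tau N i
    · subst h2
      rw [if_neg, if_neg]
      · simp [comp_tau_comp_tau, h1]
      · simp [tau_castSucc, tau_succ, h.le]
      · simp [tau_castSucc, tau_succ, h.ne']
    · have h3 : w ∘ tau N i ≠ u := by
        rintro rfl; apply h2; rw [comp_tau_comp_tau]
      simp [h1, h2, h3]

lemma TX_single_gt (q : R) (c : A → R) (i : Fin N) (u : Wd N A) (h : u i.succ < u i.castSucc) :
    TX q c i (Pi.single u 1) = (q - 1) • Pi.single u 1 + q • Pi.single (u ∘ tau N i) 1 := by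
  ext w
  rw [TX_apply]
  by_cases h1 : w = u
  · subst h1
    rw [if_neg h.ne', if_neg h.not_gt]
    simp [comp_tau_ne w i h.ne', (comp_tau_ne w i h.ne').symm]
  · by_cases h2 : w = u ∘ tau N i
    · subst h2
      rw [if_neg, if_pos]
      · simp [comp_tau_comp_tau, h1]
      · simp [tau_castSucc, tau_succ, h]
      · simp [tau_castSucc, tau_succ, h.ne]
    · have h3 : w ∘ tau N i ≠ u := by
        rintro rfl; apply h2; rw [comp_tau_comp_tau]
      simp [h1, h2, h3]

/-- weighted inversions inside blocks of equal letters of `u0`. -/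
def fw (w : A → R) (u0 : Wd N A) (v : Wp N) : R :=
  ∏ p ∈ (InvS v).filter (fun p => u0 p.1 = u0 p.2), w (u0 p.1)

lemma fw_one (w : A → R) (u0 : Wd N A) : fw w u0 1 = 1 := by
  simp [fw, InvS_one]

lemma fw_tau_eq (w : A → R) (u0 : Wd N A) (v : Wp N) (i : Fin N) (h : v i.castSucc < v i.succ)
    (he : u0 (v i.castSucc) = u0 (v i.succ)) :
    fw w u0 (v * tau N i) = w (u0 (v i.castSucc)) * fw w u0 v := by
  unfold fw
  rw [InvS_mul_tau v i h, Finset.filter_insert, if_pos he, Finset.prod_insert]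
  simp [not_mem_InvS]

lemma fw_tau_ne (w : A → R) (u0 : Wd N A) (v : Wp N) (i : Fin N)
    (he : u0 (v i.castSucc) ≠ u0 (v i.succ)) :
    fw w u0 (v * tau N i) = fw w u0 v := by
  rcases lt_or_gt_of_tau v i with h | h
  · unfold fw
    rw [InvS_mul_tau v i h, Finset.filter_insert, if_neg he]
  · have h2 := (mul_tau_lt v i).2 h
    have := InvS_mul_tau _ i h2
    rw [mul_assoc, tau_mul_self, mul_one] at this
    unfold fw
    rw [this, Finset.filter_insert, if_neg]
    simpa [tau_castSucc, tau_succ] using he.symm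

lemma fw_mul (w w' : A → R) (u0 : Wd N A) (v : Wp N) :
    fw w u0 v * fw w' u0 v = fw (fun a => w a * w' a) u0 v := by
  unfold fw; rw [Finset.prod_mul_distrib]

lemma mono_lt_iff {u0 : Wd N A} (hu : Monotone u0) (v : Wp N) (i : Fin N)
    (he : u0 (v i.castSucc) ≠ u0 (v i.succ)) :
    u0 (v i.castSucc) < u0 (v i.succ) ↔ v i.castSucc < v i.succ := by
  constructor
  · intro h
    by_contra hc
    exact absurd (hu (not_lt.1 hc)) h.not_ge
  · intro h
    exact lt_of_le_of_ne (hu h.le) he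

/-- Projection of the regular module onto the span of the orbit of `u0`. -/
def piX (c : A → R) (u0 : Wd N A) : (Wp N → R) →ₗ[R] (Wd N A → R) where
  toFun z u := ∑ v : Wp N, if u0 ∘ v = u then fw c u0 v * z v else 0
  map_add' x y := by
    ext u
    simp only [Pi.add_apply, ← Finset.sum_add_distrib]
    refine Finset.sum_congr rfl fun v _ => ?_
    split_ifs <;> ring
  map_smul' r x := by
    ext u
    simp only [Pi.smul_apply, smul_eq_mul, RingHom.id_apply, Finset.mul_sum]
    refine Finset.sum_congr rfl fun v _ => ?_
    split_ifs <;> ring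

lemma piX_apply (c : A → R) (u0 : Wd N A) (z : Wp N → R) (u : Wd N A) :
    piX c u0 z u = ∑ v : Wp N, if u0 ∘ v = u then fw c u0 v * z v else 0 := rfl

lemma piX_single (c : A → R) (u0 : Wd N A) (v : Wp N) :
    piX c u0 (Pi.single v 1) = fw c u0 v • Pi.single (u0 ∘ v) 1 := by
  ext u
  rw [piX_apply, Finset.sum_eq_single v]
  · by_cases h : u0 ∘ v = u
    · subst h; simp
    · rw [if_neg h]; simp [Ne.symm h]
  · intro w _ hw
    simp [hw]
  · simp

lemma piX_itw {q : R} {c : A → R} (hc : ∀ a, (c a - q) * (c a + 1) = 0) {u0 : Wd N A}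
    (hu : Monotone u0) : Itw (LF q) (TX q c) (piX c u0) := by
  intro i
  apply LinearMap.pi_ext'
  intro v
  ext1
  simp only [LinearMap.comp_apply, LinearMap.coe_single]
  rw [piX_single, map_smul]
  by_cases he : u0 (v i.castSucc) = u0 (v i.succ)
  · rw [TX_single_eq q c i (u0 ∘ v) he]
    have hw : u0 ∘ (v * tau N i : Wp N) = u0 ∘ v := comp_tau_eq (u0 ∘ v) i he
    rcases lt_or_gt_of_tau v i with h | h
    · rw [LF_single q i v h, piX_single, hw, fw_tau_eq c u0 v i h he, smul_smul]
      simp [mul_comm]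
    · have h2 := (mul_tau_lt v i).2 h
      have h3 := fw_tau_eq c u0 (v * tau N i) i h2
        (by simpa [tau_castSucc, tau_succ] using he.symm)
      rw [mul_assoc, tau_mul_self, mul_one] at h3
      simp only [Equiv.Perm.mul_apply, tau_castSucc] at h3
      rw [LF_single_gt q i v h, map_add, map_smul, map_smul, piX_single, piX_single, hw, smul_smul,
        smul_smul, smul_smul, ← add_smul, h3]
      congr 1
      have := hc (u0 (v i.succ))
      simp only [Function.comp, he]
      linear_combination (- fw c u0 (v * tau N i)) * this
  · have hlt := mono_lt_iff hu v i he
    rcases lt_or_gt_of_tau v i with h | h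
    · rw [LF_single q i v h, piX_single, fw_tau_ne c u0 v i he, TX_single_lt q c i (u0 ∘ v) (hlt.2 h)]
      rfl
    · have h2 : u0 (v i.succ) < u0 (v i.castSucc) := 
        lt_of_le_of_ne (hu h.le) (Ne.symm he)
      rw [LF_single_gt q i v h, map_add, map_smul, map_smul, piX_single, piX_single,
        fw_tau_ne c u0 v i he, TX_single_gt q c i (u0 ∘ v) h2, smul_add, smul_smul, smul_smul,
        smul_smul, smul_smul, mul_comm q, mul_comm (q - 1)]
      rfl

/-- Embedding of the span of the orbit of `u0` in the regular module. -/
def ioX (g : A → R) (u0 : Wd N A) : (Wd N A → R) →ₗ[R] (Wp N → R) where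
  toFun x v := fw g u0 v * x (u0 ∘ v)
  map_add' x y := by ext u; simp [mul_add]
  map_smul' r x := by ext u; simp; ring

lemma ioX_apply (g : A → R) (u0 : Wd N A) (x : Wd N A → R) (v : Wp N) :
    ioX g u0 x v = fw g u0 v * x (u0 ∘ v) := rfl

lemma ioX_itw {q : R} (hq : IsUnit q) {c g : A → R} (hc : ∀ a, (c a - q) * (c a + 1) = 0)
    (hg : ∀ a, q * g a = c a) {u0 : Wd N A}
    (hu : Monotone u0) : Itw (TX q c) (LF q) (ioX g u0) := by
  intro i
  refine LinearMap.ext fun x => ?_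
  funext v
  simp only [LinearMap.comp_apply, ioX_apply, LF_apply, TX_apply]
  by_cases he : u0 (v i.castSucc) = u0 (v i.succ)
  · have hw : u0 ∘ (v * tau N i : Wp N) = u0 ∘ v := comp_tau_eq (u0 ∘ v) i he
    have hw' : (u0 ∘ v) ∘ tau N i = u0 ∘ v := hw
    rw [if_pos (by exact he), hw]
    rcases lt_or_gt_of_tau v i with h | h
    · rw [if_pos h, fw_tau_eq g u0 v i h he]
      simp only [Function.comp]
      linear_combination (-(fw g u0 v * x (u0 ∘ v))) * hg (u0 (v i.castSucc))
    · have h2 := (mul_tau_lt v i).2 h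
      have h3 := fw_tau_eq g u0 (v * tau N i) i h2
        (by simpa [tau_castSucc, tau_succ] using he.symm)
      rw [mul_assoc, tau_mul_self, mul_one] at h3
      simp only [Equiv.Perm.mul_apply, tau_castSucc] at h3
      rw [if_neg h.not_gt, h3]
      have e1 := hc (u0 (v i.succ))
      have e2 := hg (u0 (v i.succ))
      simp only [Function.comp, he]
      apply hq.mul_left_cancel
      rw [← e2] at e1 ⊢
      simp only [Function.comp_def]
      linear_combination (fw g u0 (v * tau N i) * x (fun y => u0 (v y))) * e1
  · have hlt := mono_lt_iff hu v i he
    rw [if_neg (by exact he), comp_mul', fw_tau_ne g u0 v i he]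
    simp only [Function.comp_apply, hlt]
    split_ifs <;> ring

/-- Poincaré-type sums. -/
def Pc (w : A → R) (u0 u : Wd N A) : R := ∑ v : Wp N, if u0 ∘ v = u then fw w u0 v else 0

lemma piX_ioX (c g : A → R) (u0 : Wd N A) (x : Wd N A → R) (u : Wd N A) :
    piX c u0 (ioX g u0 x) u = Pc (fun a => c a * g a) u0 u * x u := by
  rw [piX_apply, Pc, Finset.sum_mul]
  refine Finset.sum_congr rfl fun v _ => ?_
  split_ifs with h
  · rw [ioX_apply, ← fw_mul, h]; ring
  · simp

lemma Pc_tau (w : A → R) (u0 u : Wd N A) (i : Fin N) : Pc w u0 (u ∘ tau N i) = Pc w u0 u := by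
  by_cases he : u i.castSucc = u i.succ
  · rw [comp_tau_eq u i he]
  · unfold Pc
    rw [← Equiv.sum_comp (Equiv.mulRight (tau N i))]
    refine Finset.sum_congr rfl fun v _ => ?_
    have : u0 ∘ (v * tau N i : Wp N) = u ∘ tau N i ↔ u0 ∘ v = u := by
      constructor
      · intro h
        rw [comp_mul'] at h
        have := congrArg (· ∘ tau N i) h
        simpa only [comp_tau_comp_tau] using this
      · rintro rfl; rfl
    simp only [Equiv.coe_mulRight, this]
    split_ifs with h
    · subst h
      rw [fw_tau_ne w u0 v i he]
    · rfl

lemma Pc_comp (w : A → R) (u0 u : Wd N A) (v : Wp N) : Pc w u0 (u ∘ v) = Pc w u0 u := by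
  revert v
  apply perm_induction
  · rfl
  · intro v i _ ih
    rw [comp_mul', Pc_tau, ih]

lemma Pc_eq_zero (w : A → R) {u0 : Wd N A} (hu : Monotone u0) (u : Wd N A)
    (h : u0 ≠ u ∘ Tuple.sort u) : Pc w u0 u = 0 := by
  unfold Pc
  refine Finset.sum_eq_zero fun v _ => ?_
  rw [if_neg]
  intro h1
  apply h
  have h2 : u0 = u ∘ (v⁻¹ : Wp N) := by rw [← h1]; ext x; simp
  rw [h2]
  exact (Tuple.comp_sort_eq_comp_iff_monotone).2 (h2 ▸ hu)

end Words

section TraceX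

variable {N} {R : Type} [CommRing R] {A : Type} [LinearOrder A] [Fintype A]

/-- The sorted words. -/
def Jm (N : ℕ) (A : Type) [LinearOrder A] [Fintype A] : Finset (Wd N A) :=
  Finset.univ.filter fun u => Monotone u

lemma mem_Jm (u : Wd N A) : u ∈ Jm N A ↔ Monotone u := by simp [Jm]

/-- Products of Poincaré sums. -/
def QP (w : A → R) (u1 : Wd N A) : R := ∏ u ∈ (Jm N A).erase u1, Pc w u u

/-- Product of all Poincaré sums. -/
def PP (N : ℕ) (w : A → R) : R := ∏ u ∈ Jm N A, Pc w u u

lemma QP_mul (w : A → R) (u1 : Wd N A) (h : Monotone u1) : QP w u1 * Pc w u1 u1 = PP N w :=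
  Finset.prod_erase_mul _ _ ((mem_Jm u1).2 h)

lemma sum_QP (w : A → R) (u : Wd N A) : ∑ u1 ∈ Jm N A, QP w u1 * Pc w u1 u = PP N w := by
  have hm := Tuple.monotone_sort u
  rw [Finset.sum_eq_single (u ∘ Tuple.sort u)]
  · rw [← QP_mul w _ hm]
    congr 1
    rw [Pc_comp]
  · intro u1 h1 h2
    rw [Pc_eq_zero w ((mem_Jm u1).1 h1) u h2, mul_zero]
  · intro h
    exact absurd ((mem_Jm _).2 hm) h

lemma sum_pi_io (c g : A → R) :
    ∑ u1 ∈ Jm N A, QP (fun a => c a * g a) u1 • (piX c u1 ∘ₗ ioX g u1) =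
      PP N (fun a => c a * g a) • (LinearMap.id : Module.End R (Wd N A → R)) := by
  refine LinearMap.ext fun x => ?_
  funext u
  simp only [LinearMap.sum_apply, LinearMap.smul_apply, LinearMap.comp_apply, Finset.sum_apply,
    Pi.smul_apply, smul_eq_mul, LinearMap.id_apply, piX_ioX, ← mul_assoc, ← Finset.sum_mul, sum_QP]

/-- The trace form on the endomorphisms of the word module. -/
def tX (c g : A → R) (α : Module.End R (Wd N A → R)) : R :=
  ∑ u1 ∈ Jm N A, QP (fun a => c a * g a) u1 * tF (ioX g u1 ∘ₗ α ∘ₗ piX c u1)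

lemma tX_add (c g : A → R) (α β : Module.End R (Wd N A → R)) :
    tX c g (α + β) = tX c g α + tX c g β := by
  simp [tX, LinearMap.add_comp, LinearMap.comp_add, mul_add, Finset.sum_add_distrib]

lemma tX_smul (c g : A → R) (r : R) (α : Module.End R (Wd N A → R)) :
    tX c g (r • α) = r * tX c g α := by
  simp only [tX, LinearMap.smul_comp, LinearMap.comp_smul, map_smul, Finset.mul_sum, smul_eq_mul]
  refine Finset.sum_congr rfl fun _ _ => ?_
  ring

variable {q : R} {c g : A → R}

lemma PP_smul_mid (α : Module.End R (Wd N A → R)) (u1 : Wd N A)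
    (γ : (Wp N → R) →ₗ[R] (Wd N A → R)) :
    PP N (fun a => c a * g a) * tF (ioX g u1 ∘ₗ α ∘ₗ γ) =
    ∑ u2 ∈ Jm N A, QP (fun a => c a * g a) u2 *
      tF ((ioX g u1 ∘ₗ α ∘ₗ piX c u2) ∘ₗ (ioX g u2 ∘ₗ γ)) := by
  have h : PP N (fun a => c a * g a) • (ioX g u1 ∘ₗ α ∘ₗ γ) =
     ioX g u1 ∘ₗ α ∘ₗ (PP N (fun a => c a * g a) • (LinearMap.id : Module.End R (Wd N A → R))) ∘ₗ γ := by
    simp [LinearMap.smul_comp, LinearMap.comp_smul]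
  rw [← smul_eq_mul, ← map_smul, h, ← sum_pi_io]
  have : ioX g u1 ∘ₗ α ∘ₗ (∑ u1 ∈ Jm N A, QP (fun a => c a * g a) u1 • (piX c u1 ∘ₗ ioX g u1)) ∘ₗ γ
     = ∑ u2 ∈ Jm N A, QP (fun a => c a * g a) u2 • ((ioX g u1 ∘ₗ α ∘ₗ piX c u2) ∘ₗ (ioX g u2 ∘ₗ γ)) := by
    refine LinearMap.ext fun x => ?_
    simp [LinearMap.sum_apply, map_sum]
  rw [this, map_sum]
  simp only [map_smul, smul_eq_mul]

lemma tX_comm [IsDomain R] (hq : IsUnit q) (hc : ∀ a, (c a - q) * (c a + 1) = 0)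
    (hg : ∀ a, q * g a = c a) (hP : PP N (fun a => c a * g a) ≠ 0)
    {α β : Module.End R (Wd N A → R)} (hα : Itw (TX q c) (TX q c) α)
    (hβ : Itw (TX q c) (TX q c) β) : tX c g (α * β) = tX c g (β * α) := by
  apply mul_left_cancel₀ hP
  unfold tX
  rw [Finset.mul_sum, Finset.mul_sum]
  have e : ∀ α β : Module.End R (Wd N A → R), ∀ u1 : Wd N A, PP N (fun a => c a * g a) *
      (QP (fun a => c a * g a) u1 * tF (ioX g u1 ∘ₗ (α * β) ∘ₗ piX c u1)) =
      ∑ u2 ∈ Jm N A, QP (fun a => c a * g a) u1 * (QP (fun a => c a * g a) u2 *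
      tF ((ioX g u1 ∘ₗ α ∘ₗ piX c u2) * (ioX g u2 ∘ₗ β ∘ₗ piX c u1))) := by
    intro α β u1
    rw [← Finset.mul_sum, mul_left_comm]
    congr 1
    exact PP_smul_mid α u1 (β ∘ₗ piX c u1)
  simp only [e]
  rw [Finset.sum_comm]
  refine Finset.sum_congr rfl fun u2 h2 => Finset.sum_congr rfl fun u1 h1 => ?_
  rw [mem_Jm] at h1 h2
  rw [tF_comm q]
  · ring
  · exact ((piX_itw hc h2).comp hα).comp (ioX_itw hq hc hg h1)
  · exact ((piX_itw hc h1).comp hβ).comp (ioX_itw hq hc hg h2)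

lemma tX_nondeg [IsDomain R] (hq : IsUnit q) (hc : ∀ a, (c a - q) * (c a + 1) = 0)
    (hg : ∀ a, q * g a = c a) (hP : PP N (fun a => c a * g a) ≠ 0)
    {α : Module.End R (Wd N A → R)} (hα : Itw (TX q c) (TX q c) α)
    (h : ∀ β, Itw (TX q c) (TX q c) β → tX c g (β * α) = 0) : α = 0 := by
  have key : ∀ u1 u0 : Wd N A, Monotone u1 → Monotone u0 → ioX g u1 ∘ₗ α ∘ₗ piX c u0 = 0 := by
    intro u1 u0 h1 h0
    have hi1 := ioX_itw hq hc hg h1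
    have hp0 := piX_itw hc h0
    have hmid := (hp0.comp hα).comp hi1
    refine tF_nondeg q hq hmid fun γ hγ => ?_
    apply (mul_eq_zero_iff_left hP).1
    rw [mul_comm]
    have h3 := h (piX c u0 ∘ₗ γ ∘ₗ ioX g u1) ((hi1.comp hγ).comp hp0)
    have h4 := PP_smul_mid (c := c) (g := g) α u1 (piX c u0 ∘ₗ γ)
    rw [show ((ioX g u1 ∘ₗ α ∘ₗ piX c u0) * γ) = ioX g u1 ∘ₗ α ∘ₗ (piX c u0 ∘ₗ γ) from rfl,
      mul_comm, h4, ← h3]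
    unfold tX
    refine Finset.sum_congr rfl fun u2 h2 => ?_
    rw [mem_Jm] at h2
    congr 1
    exact tF_comm q (((piX_itw hc h2).comp hα).comp hi1)
      ((hγ.comp hp0).comp (ioX_itw hq hc hg h2))
  have h5 : PP N (fun a => c a * g a) • PP N (fun a => c a * g a) • α = 0 := by
    have : PP N (fun a => c a * g a) • PP N (fun a => c a * g a) • α =
      (PP N (fun a => c a * g a) • (LinearMap.id : Module.End R (Wd N A → R))) ∘ₗ α ∘ₗ
      (PP N (fun a => c a * g a) • (LinearMap.id : Module.End R (Wd N A → R))) := by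
      simp [LinearMap.smul_comp, LinearMap.comp_smul]
    rw [this, ← sum_pi_io]
    refine LinearMap.ext fun x => ?_
    simp only [LinearMap.comp_apply, LinearMap.sum_apply, LinearMap.smul_apply, map_sum, map_smul,
      LinearMap.zero_apply]
    refine Finset.sum_eq_zero fun u1 h1 => ?_
    have : ∀ u0 ∈ Jm N A, ioX g u0 (α (piX c u1 (ioX g u1 x))) = 0 := fun u0 h0 =>
      LinearMap.congr_fun (key u0 u1 ((mem_Jm _).1 h0) ((mem_Jm _).1 h1)) (ioX g u1 x)
    rw [Finset.sum_eq_zero, smul_zero]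
    intro u0 h0
    rw [this u0 h0, map_zero, smul_zero]
  refine LinearMap.ext fun x => ?_
  funext u
  have := congrFun (LinearMap.congr_fun h5 x) u
  simpa [hP] using this

end TraceX

section Poinc

variable {N} {k} {A : Type} [LinearOrder A] [Fintype A]

/-- The exponent statistic. -/
def eS (s : A → Prop) (u0 : Wd N A) (v : Wp N) : ℕ :=
  (((InvS v).filter (fun p => u0 p.1 = u0 p.2)).filter (fun p => s (u0 p.1))).card +
  ((Finset.univ : Finset (Fin (N + 1) × Fin (N + 1))).filter
    (fun p => (p.1 < p.2 ∧ u0 p.1 = u0 p.2 ∧ ¬ s (u0 p.1)) ∧ p ∉ InvS v)).card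

lemma eS_eq_zero_iff (s : A → Prop) (u0 : Wd N A) (v : Wp N) :
    eS s u0 v = 0 ↔ ∀ a b, a < b → u0 a = u0 b →
      (s (u0 a) → v⁻¹ a < v⁻¹ b) ∧ (¬ s (u0 a) → v⁻¹ b < v⁻¹ a) := by
  have hne : ∀ a b : Fin (N + 1), a < b → v⁻¹ a ≠ v⁻¹ b := fun a b h h1 => h.ne (v⁻¹.injective h1)
  simp only [eS, Nat.add_eq_zero_iff, Finset.card_eq_zero, Finset.filter_eq_empty_iff, InvS,
    Finset.mem_filter, Finset.mem_univ, true_and, Prod.forall, true_imp_iff]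
  constructor
  · rintro ⟨h1, h2⟩ a b hab he
    have := hne a b hab
    refine ⟨fun hs => ?_, fun hs => ?_⟩
    · have h3 := h1 a b
      by_contra hc
      exact h3 ⟨⟨hab, lt_of_le_of_ne (not_lt.1 hc) this.symm⟩, he⟩ hs
    · have h3 := h2 a b
      by_contra hc
      exact h3 ⟨⟨hab, he, hs⟩, fun h => hc h.2⟩
  · intro h
    refine ⟨fun a b h1 hs => ?_, fun a b h1 => ?_⟩
    · exact absurd ((h a b h1.1.1 h1.2).1 hs) h1.1.2.not_gt
    · exact h1.2 ⟨h1.1.1, (h a b h1.1.1 h1.1.2.1).2 h1.1.2.2⟩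

/-- The injective refinement of a word. -/
def gS (s : A → Prop) (u0 : Wd N A) (x : Fin (N + 1)) : A ×ₗ Fin (N + 1) :=
  toLex (u0 x, if s (u0 x) then x else Fin.rev x)

lemma gS_inj (s : A → Prop) (u0 : Wd N A) : Function.Injective (gS s u0) := by
  intro x y h
  have h1 : (u0 x, if s (u0 x) then x else Fin.rev x) = (u0 y, if s (u0 y) then y else Fin.rev y) :=
    toLex.injective h
  rw [Prod.mk.injEq] at h1
  obtain ⟨h1, h2⟩ := h1
  rw [h1] at h2
  split_ifs at h2
  · exact h2
  · exact Fin.rev_injective h2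

lemma eS_zero_iff_sort (s : A → Prop) {u0 : Wd N A} (hu : Monotone u0) (v : Wp N) :
    (u0 ∘ v = u0 ∧ eS s u0 v = 0) ↔ v = (Tuple.sort (gS s u0))⁻¹ := by
  rw [eS_eq_zero_iff]
  constructor
  · rintro ⟨h1, h2⟩
    have h1' : ∀ x, u0 (v⁻¹ x) = u0 x := fun x => by
      have := congrFun h1 (v⁻¹ x)
      simpa using this.symm
    have hm : Monotone (gS s u0 ∘ (v⁻¹ : Wp N)) := by
      intro x y hxy
      rcases hxy.eq_or_lt with rfl | hlt
      · exact le_rfl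
      simp only [Function.comp, gS, Prod.Lex.toLex_le_toLex, h1']
      rcases (hu hxy).lt_or_eq with h | h
      · exact Or.inl h
      · right
        refine ⟨h, ?_⟩
        have := h2 x y hlt h
        rw [← h]
        split_ifs with hs
        · exact (this.1 hs).le
        · rw [Fin.rev_le_rev]; exact (this.2 hs).le
    have h3 := (Tuple.comp_sort_eq_comp_iff_monotone (f := gS s u0)).2 hm
    have h4 : Tuple.sort (gS s u0) = v⁻¹ := by
      ext1 x
      exact gS_inj s u0 (congrFun h3 x).symm
    rw [h4, inv_inv]
  · rintro rfl
    have hm : Monotone (gS s u0 ∘ Tuple.sort (gS s u0)) := Tuple.monotone_sort _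
    rw [inv_inv]
    set w := Tuple.sort (gS s u0) with hw
    have hmu : Monotone (u0 ∘ w) := by
      intro x y hxy
      have := hm hxy
      simp only [Function.comp, gS, Prod.Lex.toLex_le_toLex] at this
      rcases this with h | h
      · exact h.le
      · exact h.1.le
    have h1 : u0 ∘ w = u0 := by
      have e1 := (Tuple.comp_sort_eq_comp_iff_monotone (f := u0)).2 hmu
      have e2 := (Tuple.comp_sort_eq_comp_iff_monotone (f := u0) (σ := 1)).2 hu
      rw [e1, ← e2]; rfl
    refine ⟨?_, ?_⟩
    · conv_lhs => rw [← h1]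
      ext x; simp
    · intro a b hab he
      have h1' : ∀ x, u0 (w x) = u0 x := fun x => congrFun h1 x
      have := hm hab.le
      simp only [Function.comp, gS, Prod.Lex.toLex_le_toLex, h1'] at this
      have hne : w a ≠ w b := fun h => hab.ne (w.injective h)
      rcases this with h | h
      · exact absurd he h.ne
      · have h2 := h.2
        rw [← he] at h2
        refine ⟨fun hs => ?_, fun hs => ?_⟩
        · rw [if_pos hs, if_pos hs] at h2
          exact lt_of_le_of_ne h2 hne
        · rw [if_neg hs, if_neg hs, Fin.rev_le_rev] at h2
          exact lt_of_le_of_ne h2 hne.symm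

lemma fw_eS {R : Type} [CommRing R] (s : A → Prop) (Q Q' : R) (hQ : Q * Q' = 1) (u0 : Wd N A) (v : Wp N) :
    Q ^ ((Finset.univ : Finset (Fin (N + 1) × Fin (N + 1))).filter
      (fun p => p.1 < p.2 ∧ u0 p.1 = u0 p.2 ∧ ¬ s (u0 p.1))).card *
      fw (fun a => if s a then Q else Q') u0 v = Q ^ eS s u0 v := by
  unfold fw eS
  rw [Finset.prod_ite, Finset.prod_const, Finset.prod_const]
  set D := (Finset.univ : Finset (Fin (N + 1) × Fin (N + 1))).filter
      (fun p => p.1 < p.2 ∧ u0 p.1 = u0 p.2 ∧ ¬ s (u0 p.1)) with hD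
  have e1 : ((InvS v).filter (fun p => u0 p.1 = u0 p.2)).filter (fun p => ¬ s (u0 p.1)) =
      D.filter (fun p => p ∈ InvS v) := by
    ext p
    simp only [hD, InvS, Finset.mem_filter, Finset.mem_univ, true_and]
    tauto
  have e2 : (Finset.univ : Finset (Fin (N + 1) × Fin (N + 1))).filter
    (fun p => (p.1 < p.2 ∧ u0 p.1 = u0 p.2 ∧ ¬ s (u0 p.1)) ∧ p ∉ InvS v) =
      D.filter (fun p => p ∉ InvS v) := by
    rw [hD, Finset.filter_filter]
  rw [e1, e2, ← Finset.card_filter_add_card_filter_not (s := D) (fun p => p ∈ InvS v), pow_add, pow_add]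
  have : Q ^ (D.filter (fun p => p ∈ InvS v)).card * Q' ^ (D.filter (fun p => p ∈ InvS v)).card = 1 := by
    rw [← mul_pow, hQ, one_pow]
  linear_combination (Q ^ (D.filter (fun p => p ∉ InvS v)).card * Q ^ (((InvS v).filter (fun p => u0 p.1 = u0 p.2)).filter (fun p => s (u0 p.1))).card) * this

open Polynomial in
lemma Pc_ne_zero (s : A → Prop) (q : k) (Q' : PowerSeries k)
    (hQ : (PowerSeries.C q + PowerSeries.X) * Q' = 1) {u0 : Wd N A} (hu : Monotone u0) :
    Pc (fun a => if s a then (PowerSeries.C q + PowerSeries.X) else Q') u0 u0 ≠ 0 := by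
  intro h0
  set F : k[X] := ∑ v : Wp N, if u0 ∘ v = u0 then X ^ eS s u0 v else 0 with hF
  have hF0 : F.eval 0 = 1 := by
    rw [hF, eval_finset_sum, Finset.sum_eq_single ((Tuple.sort (gS s u0))⁻¹ : Wp N)]
    · have := (eS_zero_iff_sort s hu _).2 rfl
      rw [if_pos this.1, this.2]; simp
    · intro v _ hv
      split_ifs with h
      · have h2 : eS s u0 v ≠ 0 := fun h2 => hv ((eS_zero_iff_sort s hu v).1 ⟨h, h2⟩)
        simp [h2]
      · simp
    · simp
  have h1 : ((F.comp (X + C q) : k[X]) : PowerSeries k) = 0 := by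
    have : ((F.comp (X + C q) : k[X]) : PowerSeries k) = ∑ v : Wp N, if u0 ∘ v = u0 then
        (PowerSeries.C q + PowerSeries.X) ^ eS s u0 v else 0 := by
      rw [hF, ← Polynomial.coeToPowerSeries.ringHom_apply, Polynomial.sum_comp, map_sum]
      refine Finset.sum_congr rfl fun v _ => ?_
      split_ifs
      · simp [add_comm]
      · simp
    rw [this]
    refine Eq.trans ?_ ((congrArg (((PowerSeries.C q + PowerSeries.X) ^ ((Finset.univ : Finset (Fin (N + 1) × Fin (N + 1))).filter
      (fun p => p.1 < p.2 ∧ u0 p.1 = u0 p.2 ∧ ¬ s (u0 p.1))).card) * ·) h0).trans (mul_zero _))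
    simp only [Pc, Finset.mul_sum]
    refine Finset.sum_congr rfl fun v _ => ?_
    split_ifs
    · rw [fw_eS s _ _ hQ]
    · simp
  have h2 : F.comp (X + C q) = 0 := by
    apply Polynomial.coe_injective
    rw [h1]; simp
  have h3 : F = 0 := by
    apply Polynomial.taylor_injective q
    rw [Polynomial.taylor_apply, h2, map_zero]
  rw [h3] at hF0
  simp at hF0

end Poinc

section Homs

variable {N} {R : Type} [CommRing R] {A : Type} [LinearOrder A] [Fintype A]

/-- Inverse of the sorting permutation. -/
def dS (u : Wd N A) : Wp N := (Tuple.sort u)⁻¹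

/-- The sorted word. -/
def uS (u : Wd N A) : Wd N A := u ∘ Tuple.sort u

lemma uS_mono (u : Wd N A) : Monotone (uS u) := Tuple.monotone_sort u

lemma uS_comp (u : Wd N A) : uS u ∘ dS u = u := by
  ext x; simp [uS, dS]

lemma uS_dS (u : Wd N A) (x : Fin (N + 1)) : uS u (dS u x) = u x := congrFun (uS_comp u) x

lemma dS_lt (u : Wd N A) {a b : Fin (N + 1)} (h : u a < u b ∨ (u a = u b ∧ a < b)) :
    dS u a < dS u b := by
  by_contra hc
  rcases h with h | ⟨h1, h2⟩
  · have := uS_mono u (not_lt.1 hc)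
    rw [uS_dS, uS_dS] at this
    exact absurd h this.not_gt
  · have hlt : dS u b < dS u a := lt_of_le_of_ne (not_lt.1 hc) (fun h => h2.ne' ((dS u).injective h))
    have := (Tuple.eq_sort_iff.1 (rfl : Tuple.sort u = Tuple.sort u)).2 _ _ hlt
      (by simp [dS, h1])
    simp [dS] at this
    exact absurd h2 this.not_gt

lemma dS_lt_iff (u : Wd N A) {a b : Fin (N + 1)} :
    dS u a < dS u b ↔ u a < u b ∨ (u a = u b ∧ a < b) := by
  refine ⟨fun h => ?_, dS_lt u⟩
  by_contra hc
  push Not at hc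
  rcases hc.1.lt_or_eq with h1 | h1
  · exact absurd h (dS_lt u (Or.inl h1)).not_gt
  · rcases (hc.2 h1.symm).lt_or_eq with h2 | h2
    · exact absurd h (dS_lt u (Or.inr ⟨h1, h2⟩)).not_gt
    · subst h2; exact lt_irrefl _ h

lemma dS_tau (u : Wd N A) (i : Fin N) (h : u i.castSucc ≠ u i.succ) :
    dS (u ∘ tau N i) = dS u * tau N i := by
  have : tau N i * Tuple.sort u = Tuple.sort (u ∘ tau N i) := by
    rw [Tuple.eq_sort_iff]
    have e : ∀ x, (u ∘ tau N i) ((tau N i * Tuple.sort u) x) = u (Tuple.sort u x) := by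
      intro x; simp [tau_tau]
    constructor
    · intro x y hxy
      simp only [Function.comp_apply] at e ⊢
      rw [e, e]
      exact uS_mono u hxy
    · intro x y hxy he
      rw [e, e] at he
      have h1 := (Tuple.eq_sort_iff.1 (rfl : Tuple.sort u = Tuple.sort u)).2 _ _ hxy he
      simp only [Equiv.Perm.mul_apply]
      rw [tau_lt_tau]
      left
      refine ⟨h1, ?_⟩
      rintro ⟨h2, h3⟩
      rw [h2, h3] at he
      exact h he
  unfold dS
  rw [← this, mul_inv_rev, tau_inv]

lemma uS_tau (u : Wd N A) (i : Fin N) : uS (u ∘ tau N i) = uS u :=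
  Tuple.comp_perm_comp_sort_eq_comp_sort

lemma dS_of_mono {u : Wd N A} (h : Monotone u) : dS u = 1 := by
  unfold dS
  rw [Tuple.sort_eq_refl_iff_monotone.2 h]; rfl

lemma uS_of_mono {u : Wd N A} (h : Monotone u) : uS u = u := by
  unfold uS
  rw [Tuple.sort_eq_refl_iff_monotone.2 h]; rfl

lemma dS_consec (u : Wd N A) (i : Fin N) (h : u i.castSucc = u i.succ) :
    ∃ j : Fin N, dS u i.castSucc = j.castSucc ∧ dS u i.succ = j.succ := by
  have hlt := dS_lt u (Or.inr ⟨h, castSucc_lt_succ' i⟩)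
  have hn : ((dS u i.castSucc : Fin (N + 1)) : ℕ) < N := by
    have := (dS u i.succ).2
    have h2 : ((dS u i.castSucc : Fin (N + 1)) : ℕ) < (dS u i.succ : Fin (N + 1)) := hlt
    omega
  refine ⟨⟨_, hn⟩, rfl, ?_⟩
  by_contra hc
  set m : Fin (N + 1) := (⟨_, hn⟩ : Fin N).succ with hm
  obtain ⟨x, hx⟩ := (dS u).surjective m
  have hlt' : ((dS u i.castSucc : Fin (N + 1)) : ℕ) < (dS u i.succ : Fin (N + 1)) := hlt
  have h1 : dS u i.castSucc < dS u x := by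
    rw [hx, hm, Fin.lt_def]; simp
  have h2 : dS u x < dS u i.succ := by
    rw [hx]
    rw [Fin.ext_iff] at hc
    rw [Fin.lt_def]
    simp only [hm, Fin.val_succ] at hc ⊢
    omega
  rw [dS_lt_iff] at h1 h2
  rw [← h] at h2
  have hx1 : u i.castSucc = u x ∧ i.castSucc < x := by
    rcases h1 with h1 | h1
    · rcases h2 with h2 | h2
      · exact absurd h1 h2.not_gt
      · exact absurd h2.1 h1.ne'
    · exact h1
  have hx2 : x < i.succ := by
    rcases h2 with h2 | h2
    · exact absurd h2 hx1.1.symm.not_lt.elim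
    · exact h2.2
  have h3 := hx1.2
  simp only [Fin.lt_def, Fin.val_castSucc, Fin.val_succ] at h3 hx2
  omega

lemma fw_dS (c : A → R) (u : Wd N A) : fw c (uS u) (dS u) = 1 := by
  unfold fw
  rw [Finset.filter_eq_empty_iff.2, Finset.prod_empty]
  rintro ⟨a, b⟩ h he
  obtain ⟨x, rfl⟩ := (dS u).surjective a
  obtain ⟨y, rfl⟩ := (dS u).surjective b
  rw [mem_InvS] at h
  simp only [uS_dS] at he
  have := dS_lt u (Or.inr ⟨he.symm, h.2⟩)
  exact absurd h.1 this.not_gt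

lemma piX_dS (c : A → R) (u : Wd N A) :
    piX c (uS u) (Pi.single (dS u) 1) = Pi.single u 1 := by
  rw [piX_single, fw_dS, uS_comp, one_smul]

variable {q : R} {c : A → R}

lemma exists_Theta (hc : ∀ a, (c a - q) * (c a + 1) = 0) (y : Wd N A → R) :
    ∃ Θ : (Wp N → R) →ₗ[R] (Wd N A → R), Itw (LF q) (TX q c) Θ ∧ Θ (Pi.single 1 1) = y := by
  choose ρ h1 h2 using exists_RAlg_single (N := N) q
  refine ⟨∑ u, y u • (piX c (uS u) ∘ₗ ρ (dS u)), Itw.sum _ fun u _ => Itw.smul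
    ((RAlg_itw q (h1 (dS u))).comp (piX_itw hc (uS_mono u))) _, ?_⟩
  simp only [LinearMap.sum_apply, LinearMap.smul_apply, LinearMap.comp_apply, h2, piX_dS]
  funext w
  simp [Pi.single_apply]

lemma single_ext {ι Y : Type} [Fintype ι] [DecidableEq ι] [AddCommGroup Y] [Module R Y] {α β : (ι → R) →ₗ[R] Y}
    (h : ∀ u, α (Pi.single u 1) = β (Pi.single u 1)) : α = β := by
  apply LinearMap.pi_ext'
  intro v
  ext1
  simpa using h v

lemma X_ext (hc : ∀ a, (c a - q) * (c a + 1) = 0) {Y : Type} [AddCommGroup Y] [Module R Y]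
    {S : Fin N → Module.End R Y} {α β : (Wd N A → R) →ₗ[R] Y} (hα : Itw (TX q c) S α)
    (hβ : Itw (TX q c) S β)
    (h : ∀ u, Monotone u → α (Pi.single u 1) = β (Pi.single u 1)) : α = β := by
  apply single_ext
  intro u
  have hp := piX_itw hc (uS_mono u)
  have : α ∘ₗ piX c (uS u) = β ∘ₗ piX c (uS u) := by
    apply reg_ext (hp.comp hα) (hp.comp hβ)
    simp only [LinearMap.comp_apply, piX_single, map_smul]
    congr 1
    exact h _ (uS_mono u)
  have := LinearMap.congr_fun this (Pi.single (dS u) 1)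
  simpa only [LinearMap.comp_apply, piX_dS] using this

lemma exists_hom (hc : ∀ a, (c a - q) * (c a + 1) = 0) (y : Wd N A → Wd N A → R)
    (hy : ∀ u, Monotone u → ∀ j : Fin N, u j.castSucc = u j.succ →
      TX q c j (y u) = c (u j.castSucc) • y u) :
    ∃ φ : Module.End R (Wd N A → R), Itw (TX q c) (TX q c) φ ∧
      ∀ u, Monotone u → φ (Pi.single u 1) = y u := by
  choose Θ h1 h2 using fun u => exists_Theta hc (y u)
  let φ : Module.End R (Wd N A → R) :=
    (Pi.basisFun R (Wd N A)).constr R fun u => Θ (uS u) (Pi.single (dS u) 1)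
  have hφ : ∀ u, φ (Pi.single u 1) = Θ (uS u) (Pi.single (dS u) 1) := by
    intro u
    have := (Pi.basisFun R (Wd N A)).constr_basis R (fun u => Θ (uS u) (Pi.single (dS u) 1)) u
    rwa [Pi.basisFun_apply] at this
  refine ⟨φ, ?_, ?_⟩
  · intro i
    apply single_ext
    intro u
    simp only [LinearMap.comp_apply]
    rw [hφ]
    rcases lt_trichotomy (u i.castSucc) (u i.succ) with h | h | h
    · rw [TX_single_lt q c i u h, hφ, uS_tau, dS_tau u i h.ne, ← (h1 _).apply,
        LF_single q i _ (dS_lt u (Or.inl h))]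
    · rw [TX_single_eq q c i u h, map_smul, hφ, ← (h1 _).apply,
        LF_single q i _ (dS_lt u (Or.inr ⟨h, castSucc_lt_succ' i⟩))]
      obtain ⟨j, hj1, hj2⟩ := dS_consec u i h
      rw [← tau_mul_eq_of (dS u) i j (Or.inl ⟨hj1, hj2⟩), ← RF_single q j]
      · have hu1 : uS u j.castSucc = u i.castSucc := by rw [← hj1, uS_dS]
        have hu2 : uS u j.succ = u i.succ := by rw [← hj2, uS_dS]
        have : Θ (uS u) ∘ₗ RF q j = c (u i.castSucc) • Θ (uS u) := by
          have hR : Itw (LF q) (LF q) (RF q j : Module.End R (Wp N → R)) :=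
            RAlg_itw q (Algebra.subset_adjoin ⟨j, rfl⟩)
          apply reg_ext (hR.comp (h1 _)) ((h1 _).smul _)
          simp only [LinearMap.comp_apply, LinearMap.smul_apply]
          rw [RF_single q j 1 (by simp), mul_one, h2, ← hu1, ← hy _ (uS_mono u) j
            (by rw [hu1, hu2, h]), ← h2 (uS u), ← (h1 _).apply, LF_single q j 1 (by simp), one_mul]
        exact (LinearMap.congr_fun this (Pi.single (dS u) 1)).symm
      · rw [← hj1, ← hj2]; simp
    · rw [TX_single_gt q c i u h, map_add, map_smul, map_smul, hφ, hφ, uS_tau, dS_tau u i h.ne',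
        ← (h1 _).apply, LF_single_gt q i _ (dS_lt u (Or.inl h)), map_add, map_smul, map_smul]
  · intro u hu
    rw [hφ, uS_of_mono hu, dS_of_mono hu, h2]

end Homs

section Lift

variable {N} {A : Type} [LinearOrder A] [Fintype A]

section Om
variable {R : Type} [CommRing R]

/-- Inversion pairs of `u` among equal letters of `u0`. -/
def omS (u0 u : Wd N A) : Finset (Fin (N + 1) × Fin (N + 1)) :=
  Finset.univ.filter fun p => p.1 < p.2 ∧ u0 p.1 = u0 p.2 ∧ u p.2 < u p.1

/-- The weight of a word relative to `u0`. -/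
def om (g : A → R) (u0 u : Wd N A) : R := ∏ p ∈ omS u0 u, g (u0 p.1)

lemma om_tau (g : A → R) (u0 u : Wd N A) (j : Fin N) (h0 : u0 j.castSucc = u0 j.succ)
    (h : u j.castSucc < u j.succ) : om g u0 (u ∘ tau N j) = g (u0 j.castSucc) * om g u0 u := by
  have ht : ∀ x, u0 (tau N j x) = u0 x := fun x => congrFun (comp_tau_eq u0 j h0) x
  have e : omS u0 (u ∘ tau N j) = insert (j.castSucc, j.succ)
      ((omS u0 u).map ((tau N j).prodCongr (tau N j)).toEmbedding) := by
    ext ⟨x, y⟩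
    obtain ⟨x, rfl⟩ := (tau N j).surjective x
    obtain ⟨y, rfl⟩ := (tau N j).surjective y
    have e1 : (tau N j x, tau N j y) = ((tau N j).prodCongr (tau N j)).toEmbedding (x, y) := rfl
    rw [Finset.mem_insert]
    conv_rhs => rw [e1, Finset.mem_map']
    simp only [omS, Finset.mem_filter, Finset.mem_univ, true_and, Function.comp, tau_tau, ht,
      tau_lt_tau, Prod.mk.injEq, Equiv.toEmbedding_apply, Equiv.prodCongr_apply, Prod.map_apply]
    have hx : ∀ z w, tau N j z = w ↔ z = tau N j w := by
      intro z w; constructor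
      · rintro rfl; rw [tau_tau]
      · rintro rfl; rw [tau_tau]
    rw [hx, hx, tau_castSucc, tau_succ]
    constructor
    · rintro ⟨(⟨h1, h2⟩ | h1), h3⟩
      · exact Or.inr ⟨h1, h3⟩
      · exact Or.inl h1
    · rintro (h1 | ⟨h1, h2, h3⟩)
      · refine ⟨Or.inr h1, ?_⟩
        rw [h1.1, h1.2]
        exact ⟨h0.symm, h⟩
      · refine ⟨Or.inl ⟨h1, ?_⟩, h2, h3⟩
        rintro ⟨rfl, rfl⟩
        exact absurd h h3.not_gt
  unfold om
  rw [e, Finset.prod_insert]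
  · simp [ht]
  · intro hm
    have e1 : (j.castSucc, j.succ) = ((tau N j).prodCongr (tau N j)).toEmbedding (j.succ, j.castSucc) := by
      simp [tau_succ, tau_castSucc]
    rw [e1, Finset.mem_map'] at hm
    simp only [omS, Finset.mem_filter, Finset.mem_univ, true_and] at hm
    exact absurd hm.1 (castSucc_lt_succ' j).not_gt

lemma TX_eq_of (q : R) (hq : IsUnit q) (c : A → R) (c0 : R) (h0 : (c0 - q) * (c0 + 1) = 0)
    (j : Fin N) (y : Wd N A → R)
    (h1 : ∀ u : Wd N A, u j.castSucc = u j.succ → c (u j.castSucc) * y u = c0 * y u)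
    (h2 : ∀ u : Wd N A, u j.castSucc < u j.succ → q * y (u ∘ tau N j) = c0 * y u) :
    TX q c j y = c0 • y := by
  funext u
  rw [TX_apply]
  simp only [Pi.smul_apply, smul_eq_mul]
  split_ifs with ha hb
  · exact h1 u ha
  · exact h2 u hb
  · have h3 := h2 (u ∘ tau N j) (by
      simp only [Function.comp, tau_castSucc, tau_succ]
      exact lt_of_le_of_ne (not_lt.1 hb) (Ne.symm ha))
    rw [comp_tau_comp_tau] at h3
    apply hq.mul_left_cancel
    linear_combination (q - 1 - c0) * h3 - (y (u ∘ tau N j)) * h0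

end Om

/-- The deformed parameter. -/
def qR {k : Type} [Field k] (q : k) : PowerSeries k := PowerSeries.C q + PowerSeries.X

/-- The deformed colouring. -/
def cR {k : Type} [Field k] (q : k) (c : A → k) (a : A) : PowerSeries k :=
  if c a = q then qR q else -1

/-- The deformed ratio. -/
def gR {k : Type} [Field k] (q : k) (c : A → k) (a : A) : PowerSeries k :=
  cR q c a * (qR q)⁻¹

variable {k}

lemma cc_qR (q : k) : PowerSeries.constantCoeff (qR q) = q := by simp [qR]

lemma qR_inv (q : k) (hq : q ≠ 0) : qR q * (qR q)⁻¹ = 1 :=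
  PowerSeries.mul_inv_cancel _ (by rw [cc_qR]; exact hq)

lemma qR_unit (q : k) (hq : q ≠ 0) : IsUnit (qR q) := IsUnit.of_mul_eq_one _ (qR_inv q hq)

lemma cR_quad (q : k) (c : A → k) (a : A) : (cR q c a - qR q) * (cR q c a + 1) = 0 := by
  unfold cR; split_ifs <;> simp

lemma cc_cR (q : k) (c : A → k) (hc : ∀ a, (c a - q) * (c a + 1) = 0) (a : A) :
    PowerSeries.constantCoeff (cR q c a) = c a := by
  unfold cR
  split_ifs with h
  · rw [cc_qR, h]
  · have := (mul_eq_zero.1 (hc a)).resolve_left (sub_ne_zero.2 h)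
    simp [eq_neg_of_add_eq_zero_left this]

lemma gR_mul (q : k) (hq : q ≠ 0) (c : A → k) (a : A) : qR q * gR q c a = cR q c a := by
  unfold gR
  rw [mul_left_comm, qR_inv q hq, mul_one]

lemma PP_ne_zero (q : k) (hq : q ≠ 0) (c : A → k) :
    PP N (fun a => cR q c a * gR q c a) ≠ 0 := by
  unfold PP
  rw [Finset.prod_ne_zero_iff]
  intro u hu
  have : (fun a => cR q c a * gR q c a) = fun a => if c a = q then
      (PowerSeries.C q + PowerSeries.X) else (qR q)⁻¹ := by
    funext a
    unfold gR cR
    split_ifs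
    · rw [qR_inv q hq, mul_one]; rfl
    · ring
  rw [this]
  exact Pc_ne_zero (fun a => c a = q) q _ (qR_inv q hq) ((mem_Jm u).1 hu)

lemma exists_lift (q : k) (hq : q ≠ 0) (c : A → k) (hc : ∀ a, (c a - q) * (c a + 1) = 0)
    (φ : Module.End k (Wd N A → k)) (hφ : Itw (TX q c) (TX q c) φ) :
    ∃ ψ : Module.End (PowerSeries k) (Wd N A → PowerSeries k),
      Itw (TX (qR q) (cR q c)) (TX (qR q) (cR q c)) ψ ∧
      ∀ u, Monotone u → ∀ w, PowerSeries.constantCoeff (ψ (Pi.single u 1) w) =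
        φ (Pi.single u 1) w := by
  have hc0 : ∀ a, c a ≠ 0 := by
    intro a h
    have := hc a
    rw [h] at this
    simp [hq] at this
  have hcinj : ∀ a b, c a = c b → cR q c a = cR q c b := by
    intro a b h; unfold cR; rw [h]
  let g : A → k := fun a => c a / q
  have hg0 : ∀ a, g a ≠ 0 := fun a => div_ne_zero (hc0 a) hq
  have hom : ∀ u0 u : Wd N A, om g u0 u ≠ 0 := fun u0 u => Finset.prod_ne_zero_iff.2 fun p _ => hg0 _
  have hgR : ∀ a, PowerSeries.constantCoeff (gR q c a) = g a := by
    intro a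
    have := congrArg PowerSeries.constantCoeff (gR_mul q hq c a)
    rw [map_mul, cc_qR, cc_cR q c hc] at this
    rw [eq_div_iff hq, ← this, mul_comm]
  have homR : ∀ u0 u : Wd N A, PowerSeries.constantCoeff (om (gR q c) u0 u) = om g u0 u := by
    intro u0 u
    unfold om
    rw [map_prod]
    exact Finset.prod_congr rfl fun _ _ => hgR _
  let y : Wd N A → Wd N A → PowerSeries k := fun u0 u =>
    om (gR q c) u0 u * PowerSeries.C ((om g u0 u)⁻¹ * φ (Pi.single u0 1) u)
  obtain ⟨ψ, h1, h2⟩ := exists_hom (q := qR q) (cR_quad q c) y (by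
    intro u0 hu j hj
    have hT : TX q c j (φ (Pi.single u0 1)) = c (u0 j.castSucc) • φ (Pi.single u0 1) := by
      rw [← hφ.apply, TX_single_eq q c j u0 hj, map_smul]
    apply TX_eq_of (qR q) (qR_unit q hq) _ _ (cR_quad q c _)
    · intro u hu1
      have := congrFun hT u
      rw [TX_apply, if_pos hu1, Pi.smul_apply, smul_eq_mul] at this
      by_cases h0 : φ (Pi.single u0 1) u = 0
      · simp [y, h0]
      · rw [hcinj _ _ (mul_right_cancel₀ h0 this)]
    · intro u hu1
      have := congrFun hT u
      rw [TX_apply, if_neg hu1.ne, if_pos hu1, Pi.smul_apply, smul_eq_mul] at this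
      simp only [y]
      rw [om_tau _ u0 u j hj hu1, om_tau _ u0 u j hj hu1, ← gR_mul q hq]
      have e : (g (u0 j.castSucc) * om g u0 u)⁻¹ * φ (Pi.single u0 1) (u ∘ tau N j) =
          (om g u0 u)⁻¹ * φ (Pi.single u0 1) u := by
        have := hom u0 u
        have := hg0 (u0 j.castSucc)
        have e2 : φ (Pi.single u0 1) (u ∘ tau N j) = g (u0 j.castSucc) * φ (Pi.single u0 1) u := by
          apply mul_left_cancel₀ hq
          rw [‹q * _ = _›]
          simp only [g]
          field_simp
        rw [e2]
        field_simp
      rw [e]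
      ring)
  refine ⟨ψ, h1, fun u hu w => ?_⟩
  rw [h2 u hu]
  simp only [y, map_mul, homR, PowerSeries.constantCoeff_C]
  rw [← mul_assoc, mul_inv_cancel₀ (hom u w), one_mul]

end Lift

section Red

open PowerSeries

variable {N} {k}

lemma ring_id1 {S : Type} [Ring S] (p : S) :
    (p - (p * p - p) * (p + p - 1)) * (p - (p * p - p) * (p + p - 1)) -
      (p - (p * p - p) * (p + p - 1)) =
      ((p * p - p) * (p * p - p)) * (4 * (p * p - p) - 3) := by
  noncomm_ring

lemma ring_id2 {S : Type} [Ring S] (E p : S) :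
    E * E - E = (E - p) * E + p * (E - p) - (E - p) + (p * p - p) := by
  noncomm_ring

section Gen
variable {Ω : Type} [Fintype Ω]

/-- Reduction of endomorphisms modulo the uniformizer. -/
def red (φ : Module.End (PowerSeries k) (Ω → PowerSeries k)) : Module.End k (Ω → k) where
  toFun x u := constantCoeff (φ (fun w => C (x w)) u)
  map_add' x y := by
    funext u
    have : (fun w => C ((x + y) w)) = (fun w => (C (x w) : PowerSeries k)) + fun w => C (y w) := by
      funext w; simp
    rw [this, map_add]; simp
  map_smul' r x := by
    funext u
    have : (fun w => C ((r • x) w)) = (C r : PowerSeries k) • fun w => (C (x w) : PowerSeries k) := by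
      funext w; simp
    rw [this, map_smul]; simp

lemma red_apply (φ : Module.End (PowerSeries k) (Ω → PowerSeries k)) (x : Ω → k) (u : Ω) :
    red φ x u = constantCoeff (φ (fun w => C (x w)) u) := rfl

/-- Entrywise divisibility. -/
def Dv (n : ℕ) (φ : Module.End (PowerSeries k) (Ω → PowerSeries k)) : Prop :=
  ∀ z u, X ^ n ∣ φ z u

variable {φ ψ : Module.End (PowerSeries k) (Ω → PowerSeries k)}

lemma dvd_vec {n : ℕ} {z : Ω → PowerSeries k} (h : ∀ u, X ^ n ∣ z u) (u : Ω) :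
    X ^ n ∣ φ z u := by
  choose z' hz using h
  have : z = (X ^ n : PowerSeries k) • z' := by funext u; simp [hz u]
  rw [this, map_smul]
  exact ⟨_, rfl⟩

lemma Dv.add {n : ℕ} (h : Dv n φ) (h' : Dv n ψ) : Dv n (φ + ψ) := fun z u => dvd_add (h z u) (h' z u)

lemma Dv.neg {n : ℕ} (h : Dv n φ) : Dv n (-φ) := fun z u => (dvd_neg).2 (h z u)

lemma Dv.sub {n : ℕ} (h : Dv n φ) (h' : Dv n ψ) : Dv n (φ - ψ) := fun z u => dvd_sub (h z u) (h' z u)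

lemma Dv.mul_right {n : ℕ} (h : Dv n φ) (ψ : Module.End (PowerSeries k) (Ω → PowerSeries k)) :
    Dv n (φ * ψ) := fun z u => h (ψ z) u

lemma Dv.mul_left {n : ℕ} (h : Dv n φ) (ψ : Module.End (PowerSeries k) (Ω → PowerSeries k)) :
    Dv n (ψ * φ) := fun z u => dvd_vec (h z) u

lemma Dv.mono {n m : ℕ} (h : Dv n φ) (hm : m ≤ n) : Dv m φ :=
  fun z u => (pow_dvd_pow _ hm).trans (h z u)

lemma Dv.mul {n m : ℕ} (h : Dv n φ) (h' : Dv m ψ) : Dv (n + m) (φ * ψ) := by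
  intro z u
  choose z' hz using h' z
  have : ψ z = (X ^ m : PowerSeries k) • z' := by funext u; simp [hz u]
  rw [Module.End.mul_apply, this, map_smul, add_comm, pow_add]
  exact mul_dvd_mul_left _ (h z' u)

lemma eq_zero_of_Dv (h : ∀ n, Dv (n + 1) φ) : φ = 0 := by
  refine LinearMap.ext fun z => ?_
  funext u
  ext m
  have := (X_pow_dvd_iff.1 (h m z u)) m (Nat.lt_succ_self m)
  simpa using this

lemma red_cc (φ : Module.End (PowerSeries k) (Ω → PowerSeries k)) (z : Ω → PowerSeries k) (u : Ω) :
    red φ (fun w => constantCoeff (z w)) u = constantCoeff (φ z u) := by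
  rw [red_apply]
  have h : ∀ w, X ^ 1 ∣ (z - fun w => C (constantCoeff (z w))) w := by
    intro w
    rw [pow_one, X_dvd_iff]; simp
  have := dvd_vec (φ := φ) h u
  rw [pow_one, X_dvd_iff, map_sub] at this
  simp only [Pi.sub_apply, map_sub, sub_eq_zero] at this
  exact this.symm

lemma red_mul : red (φ * ψ) = red φ * red ψ := by
  refine LinearMap.ext fun x => ?_
  funext u
  rw [Module.End.mul_apply, red_apply, Module.End.mul_apply, ← red_cc]
  rfl

lemma red_add : red (φ + ψ) = red φ + red ψ := by
  refine LinearMap.ext fun x => ?_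
  funext u
  simp [red_apply]

lemma red_sub : red (φ - ψ) = red φ - red ψ := by
  refine LinearMap.ext fun x => ?_
  funext u
  simp [red_apply]

lemma red_smul (r : PowerSeries k) : red (r • φ) = constantCoeff r • red φ := by
  refine LinearMap.ext fun x => ?_
  funext u
  simp [red_apply]

lemma Dv_of_red (h : red φ = 0) : Dv 1 φ := by
  intro z u
  rw [pow_one, X_dvd_iff, ← red_cc, h]; rfl

lemma red_of_Dv (h : Dv 1 φ) : red φ = 0 := by
  refine LinearMap.ext fun x => ?_
  funext u
  have := h (fun w => C (x w)) u
  rw [pow_one, X_dvd_iff] at this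
  rw [red_apply, this]; rfl

lemma exists_of_Dv (h : Dv 1 φ) : ∃ φ' : Module.End (PowerSeries k) (Ω → PowerSeries k),
    φ = (X : PowerSeries k) • φ' := by
  choose f hf using h
  simp only [pow_one] at hf
  have hX : (X : PowerSeries k) ≠ 0 := X_ne_zero
  refine ⟨⟨⟨f, ?_⟩, ?_⟩, ?_⟩
  · intro x y; funext u
    apply mul_left_cancel₀ hX
    rw [← hf, map_add, Pi.add_apply, Pi.add_apply, mul_add, ← hf, ← hf]
  · intro r x; funext u
    apply mul_left_cancel₀ hX
    simp only [RingHom.id_apply, Pi.smul_apply, smul_eq_mul]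
    rw [← hf, map_smul, Pi.smul_apply, smul_eq_mul, mul_left_comm, ← hf]
  · refine LinearMap.ext fun z => ?_
    funext u
    exact hf z u

lemma smul_X_inj (h : (X : PowerSeries k) • φ = (X : PowerSeries k) • ψ) : φ = ψ := by
  refine LinearMap.ext fun z => ?_
  funext u
  have := congrFun (LinearMap.congr_fun h z) u
  simp only [LinearMap.smul_apply, Pi.smul_apply, smul_eq_mul] at this
  exact mul_left_cancel₀ X_ne_zero this

/-- Newton iteration for idempotents. -/
def nwt (e : Module.End (PowerSeries k) (Ω → PowerSeries k)) :
    ℕ → Module.End (PowerSeries k) (Ω → PowerSeries k)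
  | 0 => e
  | n + 1 => nwt e n - (nwt e n * nwt e n - nwt e n) * (nwt e n + nwt e n - 1)

lemma nwt_Dv {e : Module.End (PowerSeries k) (Ω → PowerSeries k)} (h : Dv 1 (e * e - e)) (n : ℕ) :
    Dv (n + 1) (nwt e n * nwt e n - nwt e n) := by
  induction n with
  | zero => exact h
  | succ n ih =>
    set p := nwt e n with hp
    have e1 : nwt e (n + 1) = p - (p * p - p) * (p + p - 1) := rfl
    have e2 : nwt e (n + 1) * nwt e (n + 1) - nwt e (n + 1) =
      ((p * p - p) * (p * p - p)) * (4 * (p * p - p) - 3) := by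
      rw [e1]; exact ring_id1 p
    rw [e2]
    exact ((ih.mul ih).mul_right _).mono (by omega)

lemma nwt_step {e : Module.End (PowerSeries k) (Ω → PowerSeries k)} (h : Dv 1 (e * e - e)) (n : ℕ) :
    Dv (n + 1) (nwt e n - nwt e (n + 1)) := by
  have : nwt e n - nwt e (n + 1) =
    (nwt e n * nwt e n - nwt e n) * (nwt e n + nwt e n - 1) := by
    show nwt e n - (nwt e n - _) = _
    rw [sub_sub_cancel]
  rw [this]
  exact (nwt_Dv h n).mul_right _

lemma nwt_diff {e : Module.End (PowerSeries k) (Ω → PowerSeries k)} (h : Dv 1 (e * e - e)) (n m : ℕ) :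
    Dv (n + 1) (nwt e n - nwt e (n + m)) := by
  induction m with
  | zero => intro z u; simp
  | succ m ih =>
    have : nwt e n - nwt e (n + (m + 1)) = (nwt e n - nwt e (n + m)) + (nwt e (n + m) - nwt e (n + m + 1)) := by
      rw [sub_add_sub_cancel]; rfl
    rw [this]
    exact ih.add ((nwt_step h (n + m)).mono (by omega))

lemma nwt_coeff {e : Module.End (PowerSeries k) (Ω → PowerSeries k)} (h : Dv 1 (e * e - e)) {m n : ℕ}
    (hmn : m ≤ n) (z : Ω → PowerSeries k) (u : Ω) :
    coeff m (nwt e n z u) = coeff m (nwt e m z u) := by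
  obtain ⟨d, rfl⟩ := Nat.exists_eq_add_of_le hmn
  have := (X_pow_dvd_iff.1 (nwt_diff h m d z u)) m (Nat.lt_succ_self m)
  simp only [LinearMap.sub_apply, Pi.sub_apply, map_sub, sub_eq_zero] at this
  exact this.symm

lemma nwt_itw {e : Module.End (PowerSeries k) (Ω → PowerSeries k)}
    {T : Fin N → Module.End (PowerSeries k) (Ω → PowerSeries k)} (h : Itw T T e) (n : ℕ) :
    Itw T T (nwt e n) := by
  induction n with
  | zero => exact h
  | succ n ih => exact ih.sub (((ih.mul ih).sub ih).mul ((ih.add ih).sub Itw.one))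

lemma exists_idem_lift {e : Module.End (PowerSeries k) (Ω → PowerSeries k)}
    {T : Fin N → Module.End (PowerSeries k) (Ω → PowerSeries k)} (hT : Itw T T e)
    (h : Dv 1 (e * e - e)) :
    ∃ E, Itw T T E ∧ E * E = E ∧ red E = red e := by
  let f : (Ω → PowerSeries k) → Ω → PowerSeries k := fun z u => mk fun m => coeff m (nwt e m z u)
  have hf : ∀ z u m n, m ≤ n → coeff m (f z u) = coeff m (nwt e n z u) := by
    intro z u m n hmn
    rw [nwt_coeff h hmn]; simp [f]
  let E : Module.End (PowerSeries k) (Ω → PowerSeries k) :=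
    { toFun := f
      map_add' := by
        intro x y; funext u; ext m
        rw [Pi.add_apply, map_add, hf _ _ m m le_rfl, hf _ _ m m le_rfl, hf _ _ m m le_rfl, map_add,
          Pi.add_apply, map_add]
      map_smul' := by
        intro r x; funext u; ext m
        rw [RingHom.id_apply, Pi.smul_apply, smul_eq_mul, hf _ _ m m le_rfl, map_smul,
          Pi.smul_apply, smul_eq_mul, coeff_mul, coeff_mul]
        refine Finset.sum_congr rfl fun p hp => ?_
        rw [hf _ _ p.2 m (by have := Finset.HasAntidiagonal.mem_antidiagonal.1 hp; omega)] }
  have hE : ∀ n, Dv (n + 1) (E - nwt e n) := by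
    intro n z u
    rw [X_pow_dvd_iff]
    intro m hm
    rw [LinearMap.sub_apply, Pi.sub_apply, map_sub, sub_eq_zero]
    exact hf z u m n (by omega)
  refine ⟨E, ?_, ?_, ?_⟩
  · intro i
    rw [← sub_eq_zero]
    apply eq_zero_of_Dv
    intro n
    have h1 := nwt_itw hT n i
    have : (E ∘ₗ T i - T i ∘ₗ E : Module.End _ _) = (E - nwt e n) * T i - T i * (E - nwt e n) := by
      have h1' : nwt e n * T i = T i * nwt e n := h1
      rw [sub_mul, mul_sub, h1']
      show E * T i - T i * E = _
      abel
    rw [this]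
    exact ((hE n).mul_right _).sub ((hE n).mul_left _)
  · rw [← sub_eq_zero]
    apply eq_zero_of_Dv
    intro n
    have : E * E - E = (E - nwt e n) * E + nwt e n * (E - nwt e n) - (E - nwt e n) +
        (nwt e n * nwt e n - nwt e n) := ring_id2 E (nwt e n)
    rw [this]
    exact ((((hE n).mul_right _).add ((hE n).mul_left _)).sub (hE n)).add (nwt_Dv h n)
  · rw [← sub_eq_zero, ← red_sub]
    exact red_of_Dv (hE 0)

end Gen

variable {A : Type} [LinearOrder A] [Fintype A]

lemma red_TX (q : k) (c : A → k) (hc : ∀ a, (c a - q) * (c a + 1) = 0) (i : Fin N) :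
    red (TX (qR q) (cR q c) i) = TX q c i := by
  refine LinearMap.ext fun x => ?_
  funext u
  rw [red_apply, TX_apply, TX_apply]
  split_ifs <;> simp [cc_qR, cc_cR q c hc]

lemma red_itw {q : k} {c : A → k} (hc : ∀ a, (c a - q) * (c a + 1) = 0)
    {φ : Module.End (PowerSeries k) (Wd N A → PowerSeries k)}
    (h : Itw (TX (qR q) (cR q c)) (TX (qR q) (cR q c)) φ) : Itw (TX q c) (TX q c) (red φ) := by
  intro i
  have := congrArg red (h i)
  have h2 : red (φ * TX (qR q) (cR q c) i) = red (TX (qR q) (cR q c) i * φ) := this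
  rw [red_mul, red_mul, red_TX q c hc] at h2
  exact h2

lemma exists_lift' (q : k) (hq : q ≠ 0) (c : A → k) (hc : ∀ a, (c a - q) * (c a + 1) = 0)
    (φ : Module.End k (Wd N A → k)) (hφ : Itw (TX q c) (TX q c) φ) :
    ∃ ψ : Module.End (PowerSeries k) (Wd N A → PowerSeries k),
      Itw (TX (qR q) (cR q c)) (TX (qR q) (cR q c)) ψ ∧ red ψ = φ := by
  obtain ⟨ψ, h1, h2⟩ := exists_lift q hq c hc φ hφ
  refine ⟨ψ, h1, X_ext hc (red_itw hc h1) hφ fun u hu => ?_⟩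
  funext w
  rw [← h2 u hu, red_apply]
  have e : (fun w' => C ((Pi.single u 1 : Wd N A → k) w')) = (Pi.single u 1 : Wd N A → PowerSeries k) := by
    funext w'
    by_cases hw : w' = u
    · subst hw; simp
    · simp [hw]
  rw [e]

lemma exists_idemX (q : k) (hq : q ≠ 0) (c : A → k) (hc : ∀ a, (c a - q) * (c a + 1) = 0)
    (e : Module.End k (Wd N A → k)) (he : Itw (TX q c) (TX q c) e) (hee : e * e = e) :
    ∃ E : Module.End (PowerSeries k) (Wd N A → PowerSeries k),
      Itw (TX (qR q) (cR q c)) (TX (qR q) (cR q c)) E ∧ E * E = E ∧ red E = e := by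
  obtain ⟨ψ, h1, h2⟩ := exists_lift' q hq c hc e he
  obtain ⟨E, h3, h4, h5⟩ := exists_idem_lift h1 (Dv_of_red (by
    rw [red_sub, red_mul, h2, hee, sub_self]))
  exact ⟨E, h3, h4, h5.trans h2⟩

end Red

section Rank

open PowerSeries

variable {N} {k}

lemma finrank_red {E E' : Type} [AddCommGroup E] [Module (PowerSeries k) E]
    [Module.Free (PowerSeries k) E] [Module.Finite (PowerSeries k) E]
    [AddCommGroup E'] [Module k E'] (ρ : E → E') (ha : ∀ x y, ρ (x + y) = ρ x + ρ y)
    (hs : ∀ (r : PowerSeries k) x, ρ (r • x) = constantCoeff r • ρ x)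
    (hsurj : ∀ y, ∃ x, ρ x = y) (hker : ∀ x, ρ x = 0 → ∃ x', x = (X : PowerSeries k) • x') :
    Module.finrank (PowerSeries k) E = Module.finrank k E' := by
  let b := Module.Free.chooseBasis (PowerSeries k) E
  let ρ' : E →+ E' := AddMonoidHom.mk' ρ ha
  have hsum : ∀ {ι : Type} (s : Finset ι) (f : ι → E), ρ (∑ i ∈ s, f i) = ∑ i ∈ s, ρ (f i) :=
    fun s f => map_sum ρ' f s
  have hli : LinearIndependent k fun i => ρ (b i) := by
    rw [Fintype.linearIndependent_iff]
    intro a h i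
    have h1 : ρ (∑ i, (C (a i) : PowerSeries k) • b i) = 0 := by
      rw [hsum, ← h]
      refine Finset.sum_congr rfl fun j _ => ?_
      rw [hs, constantCoeff_C]
    obtain ⟨x', hx⟩ := hker _ h1
    have h2 := congrArg (fun z => b.repr z i) hx
    simp only [map_smul, Finsupp.smul_apply, smul_eq_mul] at h2
    rw [b.repr_sum_self] at h2
    have h3 := congrArg constantCoeff h2
    simpa using h3
  have hsp : ⊤ ≤ Submodule.span k (Set.range fun i => ρ (b i)) := by
    intro y _
    obtain ⟨x, rfl⟩ := hsurj y
    rw [← b.sum_repr x, hsum]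
    refine Submodule.sum_mem _ fun i _ => ?_
    rw [hs]
    exact Submodule.smul_mem _ _ (Submodule.subset_span ⟨i, rfl⟩)
  rw [Module.finrank_eq_card_basis b, Module.finrank_eq_card_basis (Module.Basis.mk hli hsp)]

lemma finrank_le_of_pairing {R E E' : Type} [CommRing R] [IsDomain R]
    [AddCommGroup E] [Module R E] [AddCommGroup E'] [Module R E']
    [Module.Free R E'] [Module.Finite R E']
    (B : E → E' → R) (h1 : ∀ a b d, B (a + b) d = B a d + B b d)
    (h2 : ∀ (r : R) a d, B (r • a) d = r • B a d)
    (h3 : ∀ a b d, B a (b + d) = B a b + B a d)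
    (h4 : ∀ (r : R) a d, B a (r • d) = r • B a d)
    (hB : ∀ a, (∀ d, B a d = 0) → a = 0) :
    Module.finrank R E ≤ Module.finrank R E' := by
  have hi : Function.Injective (LinearMap.mk₂ R B h1 h2 h3 h4) := by
    rw [injective_iff_map_eq_zero]
    exact fun a h => hB a fun d => LinearMap.congr_fun h d
  exact (LinearMap.finrank_le_finrank_of_injective hi).trans (Module.finrank_linearMap_self R R E').le

/-- Intertwiners cut by idempotents. -/
def cut {R V : Type} [CommRing R] [AddCommGroup V] [Module R V] (T : Fin N → Module.End R V)
    (e f : Module.End R V) : Submodule R (Module.End R V) where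
  carrier := {φ | Itw T T φ ∧ f * φ = φ ∧ φ * e = φ}
  add_mem' := by
    rintro a b ⟨h1, h2, h3⟩ ⟨h4, h5, h6⟩
    exact ⟨h1.add h4, by rw [mul_add, h2, h5], by rw [add_mul, h3, h6]⟩
  zero_mem' := ⟨Itw.zero, by simp, by simp⟩
  smul_mem' := by
    rintro r a ⟨h1, h2, h3⟩
    exact ⟨h1.smul r, by rw [mul_smul_comm, h2], by rw [smul_mul_assoc, h3]⟩

variable {A : Type} [LinearOrder A] [Fintype A]

instance cut_finite (T : Fin N → Module.End (PowerSeries k) (Wd N A → PowerSeries k))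
    (e f : Module.End (PowerSeries k) (Wd N A → PowerSeries k)) :
    Module.Finite (PowerSeries k) (cut T e f) := by
  haveI : IsNoetherian (PowerSeries k) (Module.End (PowerSeries k) (Wd N A → PowerSeries k)) :=
    isNoetherian_of_isNoetherianRing_of_finite _ _
  exact Module.IsNoetherian.finite _ _

instance cut_free (T : Fin N → Module.End (PowerSeries k) (Wd N A → PowerSeries k))
    (e f : Module.End (PowerSeries k) (Wd N A → PowerSeries k)) :
    Module.Free (PowerSeries k) (cut T e f) := by
  haveI : Module.Free (PowerSeries k) (Module.End (PowerSeries k) (Wd N A → PowerSeries k)) :=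
    Module.Free.linearMap _ _ _ _
  obtain ⟨n, ⟨b⟩⟩ := Submodule.nonempty_basis_of_pid
    (Module.Free.chooseBasis (PowerSeries k)
      (Module.End (PowerSeries k) (Wd N A → PowerSeries k))) (cut T e f)
  exact Module.Free.of_basis b

lemma cut_finrank_red {q : k} (hq : q ≠ 0) {c : A → k} (hc : ∀ a, (c a - q) * (c a + 1) = 0)
    {e f : Module.End (PowerSeries k) (Wd N A → PowerSeries k)}
    (he : Itw (TX (qR q) (cR q c)) (TX (qR q) (cR q c)) e) (hee : e * e = e)
    (hf : Itw (TX (qR q) (cR q c)) (TX (qR q) (cR q c)) f) (hff : f * f = f) :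
    Module.finrank (PowerSeries k) (cut (TX (qR q) (cR q c)) e f) =
      Module.finrank k (cut (TX q c) (red e) (red f)) := by
  refine finrank_red (E := cut (TX (qR q) (cR q c)) e f) (E' := cut (TX q c) (red e) (red f))
    (fun φ => ⟨red φ.1, red_itw hc φ.2.1, ?_, ?_⟩) ?_ ?_ ?_ ?_
  · rw [← red_mul, φ.2.2.1]
  · rw [← red_mul, φ.2.2.2]
  · intro x y; exact Subtype.ext red_add
  · intro r x; exact Subtype.ext (red_smul r)
  · rintro ⟨y, hy1, hy2, hy3⟩
    obtain ⟨ψ, h1, h2⟩ := exists_lift' q hq c hc y hy1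
    refine ⟨⟨f * ψ * e, (hf.mul h1).mul he, ?_, ?_⟩, ?_⟩
    · rw [← mul_assoc, ← mul_assoc, hff]
    · rw [mul_assoc, hee]
    · apply Subtype.ext
      show red (f * ψ * e) = y
      rw [red_mul, red_mul, h2, hy2, hy3]
  · rintro ⟨x, hx1, hx2, hx3⟩ h
    have h' : red x = 0 := congrArg Subtype.val h
    obtain ⟨x', rfl⟩ := exists_of_Dv (Dv_of_red h')
    refine ⟨⟨x', fun i => ?_, ?_, ?_⟩, rfl⟩
    · apply smul_X_inj
      rw [← LinearMap.smul_comp, ← LinearMap.comp_smul, hx1 i]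
    · apply smul_X_inj
      rw [← mul_smul_comm, hx2]
    · apply smul_X_inj
      rw [← smul_mul_assoc, hx3]

lemma cut_le {q : k} (hq : q ≠ 0) {c : A → k}
    {e f : Module.End (PowerSeries k) (Wd N A → PowerSeries k)}
    (he : Itw (TX (qR q) (cR q c)) (TX (qR q) (cR q c)) e) (hee : e * e = e)
    (hf : Itw (TX (qR q) (cR q c)) (TX (qR q) (cR q c)) f) (hff : f * f = f) :
    Module.finrank (PowerSeries k) (cut (TX (qR q) (cR q c)) e f) ≤
      Module.finrank (PowerSeries k) (cut (TX (qR q) (cR q c)) f e) := by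
  refine finrank_le_of_pairing (R := PowerSeries k) (E := cut (TX (qR q) (cR q c)) e f)
    (E' := cut (TX (qR q) (cR q c)) f e) (fun α β => tX (cR q c) (gR q c) (β.1 * α.1))
      (by intro a b d; simp only [Submodule.coe_add, mul_add]; exact tX_add _ _ _ _)
      (by intro r a d; simp only [Submodule.coe_smul, mul_smul_comm]; exact tX_smul _ _ _ _)
      (by intro a b d; simp only [Submodule.coe_add, add_mul]; exact tX_add _ _ _ _)
      (by intro r a d; simp only [Submodule.coe_smul, smul_mul_assoc]; exact tX_smul _ _ _ _) ?_
  · rintro ⟨α, h1, h2, h3⟩ h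
    apply Subtype.ext
    have hqu := qR_unit q hq
    have hcq := cR_quad q c
    have hgq := gR_mul q hq c
    have hP := PP_ne_zero (N := N) q hq c
    refine tX_nondeg hqu hcq hgq hP h1 fun γ hγ => ?_
    have e1 : γ * α = (γ * f * α) * e := by
      rw [mul_assoc, mul_assoc, h3, h2]
    rw [e1, tX_comm hqu hcq hgq hP ((hγ.mul hf).mul h1) he]
    have h4 := h ⟨e * γ * f, (he.mul hγ).mul hf,
      by rw [← mul_assoc, ← mul_assoc, hee], by rw [mul_assoc, hff]⟩
    have h5 : tX (cR q c) (gR q c) (e * γ * f * α) = 0 := h4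
    rw [← h5]
    simp only [mul_assoc]

lemma cut_symm {q : k} (hq : q ≠ 0) {c : A → k} (hc : ∀ a, (c a - q) * (c a + 1) = 0)
    {e f : Module.End k (Wd N A → k)}
    (he : Itw (TX q c) (TX q c) e) (hee : e * e = e)
    (hf : Itw (TX q c) (TX q c) f) (hff : f * f = f) :
    Module.finrank k (cut (TX q c) e f) = Module.finrank k (cut (TX q c) f e) := by
  obtain ⟨E, h1, h2, rfl⟩ := exists_idemX q hq c hc e he hee
  obtain ⟨F, h4, h5, rfl⟩ := exists_idemX q hq c hc f hf hff
  rw [← cut_finrank_red hq hc h1 h2 h4 h5, ← cut_finrank_red hq hc h4 h5 h1 h2]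
  exact le_antisymm (cut_le hq h1 h2 h4 h5) (cut_le hq h4 h5 h1 h2)

end Rank

section Transfer

variable {N}

lemma ap_inv (v : Wp N) (x : Fin (N + 1)) : v (v⁻¹ x) = x := by simp

lemma card_InvS_mul_tau_le (v : Wp N) (i : Fin N) :
    (InvS (v * tau N i)).card ≤ (InvS v).card + 1 := by
  rcases lt_or_gt_of_tau v i with h | h
  · rw [InvS_mul_tau v i h, Finset.card_insert_of_notMem (not_mem_InvS _ i)]
  · have h2 := (mul_tau_lt v i).2 h
    have h4 := InvS_mul_tau _ i h2
    rw [mul_assoc, tau_mul_self, mul_one] at h4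
    rw [h4, Finset.card_insert_of_notMem (not_mem_InvS _ i)]
    omega

lemma card_InvS_le (l : List (Fin N)) : (InvS (l.map (tau N)).prod).card ≤ l.length := by
  induction l using List.reverseRecOn with
  | nil => simp [InvS_one]
  | append_singleton l i ih =>
    rw [List.map_append, List.prod_append, List.map_singleton, List.prod_singleton,
      List.length_append, List.length_singleton]
    exact (card_InvS_mul_tau_le _ i).trans (by omega)

lemma exists_word (v : Wp N) :
    ∃ l : List (Fin N), l.length = (InvS v).card ∧ (l.map (tau N)).prod = v := by
  induction v using perm_induction with
  | h1 => exact ⟨[], by simp [InvS_one], by simp⟩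
  | hs v i h ih =>
    obtain ⟨l, h1, h2⟩ := ih
    refine ⟨l ++ [i], ?_, ?_⟩
    · rw [InvS_mul_tau v i h, Finset.card_insert_of_notMem (not_mem_InvS _ i)]
      simp [h1]
    · simp [h2]

lemma len_eq (v : Wp N) : len N v = (InvS v).card := by
  apply le_antisymm
  · exact Nat.sInf_le (exists_word v)
  · refine le_csInf ⟨_, exists_word v⟩ fun m hm => ?_
    obtain ⟨l, rfl, rfl⟩ := hm
    exact card_InvS_le l

lemma card_InvS_inv (v : Wp N) : (InvS v⁻¹).card = (InvS v).card := by
  refine Finset.card_nbij' (fun p => (v p.2, v p.1)) (fun p => (v⁻¹ p.2, v⁻¹ p.1)) ?_ ?_ ?_ ?_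
  · rintro ⟨a, b⟩ h
    simp [InvS] at h ⊢
    exact ⟨h.2, h.1⟩
  · rintro ⟨a, b⟩ h
    simp [InvS] at h ⊢
    exact ⟨h.2, h.1⟩
  · rintro ⟨a, b⟩ h; simp
  · rintro ⟨a, b⟩ h; simp

lemma len_mul_tau (v : Wp N) (i : Fin N) (h : v i.castSucc < v i.succ) :
    len N (v * tau N i) = len N v + 1 := by
  rw [len_eq, len_eq, InvS_mul_tau v i h, Finset.card_insert_of_notMem (not_mem_InvS _ i)]

lemma len_inv (v : Wp N) : len N v⁻¹ = len N v := by
  rw [len_eq, len_eq, card_InvS_inv]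

lemma len_tau_mul (v : Wp N) (i : Fin N) (h : v⁻¹ i.castSucc < v⁻¹ i.succ) :
    len N (tau N i * v) = len N v + 1 := by
  rw [← len_inv, mul_inv_rev, tau_inv, len_mul_tau _ _ h, len_inv]

lemma len_lt_iff (v : Wp N) (i : Fin N) :
    len N v < len N (tau N i * v) ↔ v⁻¹ i.castSucc < v⁻¹ i.succ := by
  constructor
  · intro h
    refine (lt_or_gt_of_tau v⁻¹ i).resolve_right fun h1 => ?_
    have h2 := len_tau_mul (tau N i * v) i (by
      rw [mul_inv_rev, tau_inv, mul_tau_lt]; exact h1)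
    rw [← mul_assoc, tau_mul_self, one_mul] at h2
    omega
  · intro h
    rw [len_tau_mul v i h]; omega

/-- Block number. -/
def blk (B : Set (Fin N)) (a : Fin (N + 1)) : Fin (N + 1) :=
  ⟨(Finset.univ.filter fun j : Fin N => j ∉ B ∧ j.castSucc < a).card,
    Nat.lt_succ_of_le ((Finset.card_filter_le _ _).trans (by simp))⟩

lemma blk_mono (B : Set (Fin N)) : Monotone (blk B) := by
  intro a b h
  refine Fin.le_def.2 (Finset.card_le_card (?_ : (Finset.univ.filter fun j : Fin N =>
    j ∉ B ∧ j.castSucc < a) ⊆ Finset.univ.filter fun j : Fin N => j ∉ B ∧ j.castSucc < b))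
  intro j
  simp only [Finset.mem_filter, Finset.mem_univ, true_and]
  exact fun h1 => ⟨h1.1, h1.2.trans_le h⟩

lemma blk_succ_iff (B : Set (Fin N)) (j : Fin N) :
    blk B j.castSucc = blk B j.succ ↔ j ∈ B := by
  constructor
  · intro h
    by_contra hj
    have h1 : (Finset.univ.filter fun j' : Fin N => j' ∉ B ∧ j'.castSucc < j.castSucc).card =
      (Finset.univ.filter fun j' : Fin N => j' ∉ B ∧ j'.castSucc < j.succ).card :=
      congrArg Fin.val h
    refine absurd h1 (Finset.card_lt_card ?_).ne
    rw [Finset.ssubset_iff_of_subset]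
    · exact ⟨j, by simp [hj], by simp⟩
    · intro j'
      simp only [Finset.mem_filter, Finset.mem_univ, true_and]
      exact fun h1 => ⟨h1.1, h1.2.trans (castSucc_lt_succ' j)⟩
  · intro hj
    apply Fin.ext
    show (Finset.univ.filter fun j' : Fin N => j' ∉ B ∧ j'.castSucc < j.castSucc).card =
      (Finset.univ.filter fun j' : Fin N => j' ∉ B ∧ j'.castSucc < j.succ).card
    congr 1
    ext j'
    simp only [Finset.mem_filter, Finset.mem_univ, true_and]
    refine and_congr_right fun h1 => ?_
    have : j' ≠ j := by rintro rfl; exact h1 hj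
    simp only [Fin.lt_def, Fin.val_castSucc, Fin.val_succ, ne_eq, Fin.ext_iff] at *
    omega

lemma blk_tau (B : Set (Fin N)) {j : Fin N} (hj : j ∈ B) (x : Fin (N + 1)) :
    blk B (tau N j x) = blk B x :=
  congrFun (comp_tau_eq (blk B) j ((blk_succ_iff B j).2 hj)) x

lemma blk_young (B : Set (Fin N)) {s : Wp N} (hs : s ∈ youngSubgroup N B) (x : Fin (N + 1)) :
    blk B (s x) = blk B x := by
  induction hs using Subgroup.closure_induction generalizing x with
  | mem s h =>
    obtain ⟨j, hj, rfl⟩ := h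
    exact blk_tau B hj x
  | one => rfl
  | mul a b _ _ iha ihb => rw [Equiv.Perm.mul_apply, iha, ihb]
  | inv a _ ih => rw [← ih (a⁻¹ x)]; simp

lemma good_of_dist {B : Set (Fin N)} {d : Wp N} (hd : IsDistL N B d) :
    ∀ b a, a < b → blk B a = blk B b → d a < d b := by
  intro b
  induction b using Fin.induction with
  | zero => intro a h; exact absurd h (Fin.not_lt_zero a)
  | succ j ih =>
    intro a hab hbl
    have h1 : a ≤ j.castSucc := by
      simp only [Fin.le_def, Fin.lt_def, Fin.val_castSucc, Fin.val_succ] at *; omega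
    have h2 : blk B a = blk B j.castSucc :=
      le_antisymm (blk_mono B h1) (hbl ▸ blk_mono B (castSucc_lt_succ' j).le)
    have hj : j ∈ B := (blk_succ_iff B j).1 (h2.symm.trans hbl)
    have h3 : d j.castSucc < d j.succ := by
      refine (lt_or_gt_of_tau d j).resolve_right fun h4 => ?_
      have h5 := hd (tau N j) (Subgroup.subset_closure ⟨j, hj, rfl⟩)
      have h6 := len_mul_tau (d * tau N j) j ((mul_tau_lt d j).2 h4)
      rw [mul_assoc, tau_mul_self, mul_one] at h6
      omega
    rcases h1.lt_or_eq with h4 | h4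
    · exact (ih a h4 h2).trans h3
    · rw [h4]; exact h3

lemma blk_lt_imp (B : Set (Fin N)) {a b : Fin (N + 1)} (h : blk B a < blk B b) : a < b :=
  lt_of_not_ge fun h1 => absurd h (blk_mono B h1).not_gt

lemma dist_of_good {B : Set (Fin N)} {d : Wp N}
    (hd : ∀ b a, a < b → blk B a = blk B b → d a < d b) : IsDistL N B d := by
  intro s hs
  rw [len_eq, len_eq]
  apply Finset.card_le_card
  rintro ⟨a, b⟩ h
  simp only [InvS, Finset.mem_filter, Finset.mem_univ, true_and] at h ⊢
  refine ⟨h.1, ?_⟩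
  have h1 : blk B (d⁻¹ b) < blk B (d⁻¹ a) := by
    refine lt_of_le_of_ne (blk_mono B h.2.le) fun h2 => ?_
    have := hd _ _ h.2 h2
    simp at this
    exact absurd h.1 this.not_gt
  apply blk_lt_imp B
  rw [mul_inv_rev, Equiv.Perm.mul_apply, Equiv.Perm.mul_apply, blk_young B (inv_mem hs),
    blk_young B (inv_mem hs)]
  exact h1

lemma dist_unique {B : Set (Fin N)} {d d' : Wp N} (hd : IsDistL N B d) (hd' : IsDistL N B d')
    (h : ∀ x, blk B (d⁻¹ x) = blk B (d'⁻¹ x)) : d = d' := by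
  have hb : ∀ x, blk B ((d'⁻¹ * d) x) = blk B x := fun x => by
    rw [Equiv.Perm.mul_apply, ← h]; simp
  have : d'⁻¹ * d = 1 := by
    refine eq_one_of_lt _ fun i => ?_
    refine (lt_or_gt_of_tau _ i).resolve_right fun h1 => ?_
    have h2 := blk_mono B h1.le
    rw [hb, hb] at h2
    have h3 := le_antisymm h2 (blk_mono B (castSucc_lt_succ' i).le)
    have h4 := good_of_dist hd _ _ (castSucc_lt_succ' i) h3.symm
    have h5 := good_of_dist hd' _ _ h1 (by rw [hb, hb, h3])
    simp at h5
    exact absurd h4 h5.not_gt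
  exact (inv_mul_eq_one.1 this).symm

lemma conj_tau_iff {B : Set (Fin N)} {d : Wp N} (hd : IsDistL N B d) (i : Fin N) :
    (∃ j, j ∈ B ∧ d⁻¹ * tau N i * d = tau N j) ↔
      blk B (d⁻¹ i.castSucc) = blk B (d⁻¹ i.succ) := by
  constructor
  · rintro ⟨j, hj, h⟩
    have := congrArg (fun v : Wp N => v (d⁻¹ i.castSucc)) h
    simp only [Equiv.Perm.mul_apply, ap_inv, tau_castSucc] at this
    rw [this, blk_tau B hj]
  · intro h
    have hlt : d⁻¹ i.castSucc < d⁻¹ i.succ := by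
      refine (lt_or_gt_of_tau _ i).resolve_right fun h1 => ?_
      have := good_of_dist hd _ _ h1 h.symm
      rw [ap_inv, ap_inv] at this
      exact absurd this (castSucc_lt_succ' i).not_gt
    obtain ⟨j, hj⟩ : ∃ j : Fin N, j.castSucc = d⁻¹ i.castSucc :=
      ⟨⟨(d⁻¹ i.castSucc).val, by have := (d⁻¹ i.succ).isLt; rw [Fin.lt_def] at hlt; omega⟩, rfl⟩
    have hle : j.succ ≤ d⁻¹ i.succ := by
      rw [← hj] at hlt
      simp only [Fin.le_def, Fin.lt_def, Fin.val_castSucc, Fin.val_succ] at *; omega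
    have hb : blk B j.castSucc = blk B j.succ := by
      refine le_antisymm (blk_mono B (castSucc_lt_succ' j).le) ?_
      rw [hj, h]; exact blk_mono B hle
    have hs : j.succ = d⁻¹ i.succ := by
      by_contra hne
      have h1 := good_of_dist hd _ _ (lt_of_le_of_ne hle hne) (by rw [← hb, hj, h])
      have h2 := good_of_dist hd _ _ (castSucc_lt_succ' j) hb
      rw [hj] at h2
      simp only [ap_inv] at h1 h2
      simp only [Fin.lt_def, Fin.val_castSucc, Fin.val_succ] at h1 h2; omega
    refine ⟨j, (blk_succ_iff B j).1 hb, ?_⟩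
    rw [tau, tau, hj, hs, mul_assoc, Equiv.swap_mul_eq_mul_swap, ← mul_assoc]
    simp

lemma conj_tau_blk {B : Set (Fin N)} {d : Wp N} {i j : Fin N} (hj : j ∈ B)
    (h : d⁻¹ * tau N i * d = tau N j) : blk B (d⁻¹ i.castSucc) = blk B j.castSucc := by
  have := congrArg (fun v : Wp N => v (d⁻¹ i.castSucc)) h
  simp only [Equiv.Perm.mul_apply, ap_inv, tau_castSucc] at this
  rw [tau_apply] at this
  split_ifs at this with h1 h2
  · rw [h1]
  · rw [h2, (blk_succ_iff B j).2 hj]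
  · exact absurd (d⁻¹.injective this) (castSucc_ne_succ' i).symm

lemma dist_tau_mul {B : Set (Fin N)} {d : Wp N} (hd : IsDistL N B d) (i : Fin N)
    (h : blk B (d⁻¹ i.castSucc) ≠ blk B (d⁻¹ i.succ)) : IsDistL N B (tau N i * d) := by
  apply dist_of_good
  intro b a hab hbl
  rw [Equiv.Perm.mul_apply, Equiv.Perm.mul_apply, tau_lt_tau]
  refine Or.inl ⟨good_of_dist hd _ _ hab hbl, ?_⟩
  rintro ⟨h1, h2⟩
  apply h
  rw [← h1, ← h2]; simpa using hbl

end Transfer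

section Embed

variable {N} {k}

lemma chi_eq {q : k} (hq : q ≠ 0) {B : Set (Fin N)} {χ : Fin N → k} (h : IsOneDimRep k N q B χ)
    (n : ℕ) : ∀ j j' : Fin N, j'.val = j.val + n → j ∈ B → j' ∈ B →
      blk B j.castSucc = blk B j'.castSucc → χ j = χ j' := by
  have hne : ∀ i ∈ B, χ i ≠ 0 := by
    intro i hi h0
    have := h.1 i hi
    rw [h0] at this
    simp [hq] at this
  induction n with
  | zero =>
    intro j j' h1 _ _ _
    have : j' = j := Fin.ext h1
    rw [this]
  | succ n ih =>
    intro j j' h1 hj hj' hb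
    let m : Fin N := ⟨j.val + n, by have := j'.isLt; omega⟩
    have hm : m.succ = j'.castSucc := Fin.ext (by simp [m, h1]; omega)
    have hjm : j.castSucc ≤ m.castSucc := by simp [Fin.le_def, m]
    have h2 : blk B j.castSucc = blk B m.castSucc := by
      refine le_antisymm (blk_mono B hjm) ?_
      rw [hb, ← hm]; exact blk_mono B (castSucc_lt_succ' m).le
    have hmB : m ∈ B := by
      rw [← blk_succ_iff, hm, ← h2, hb]
    rw [ih j m rfl hj hmB h2]
    have h3 := h.2 m hmB j' hj' (Or.inl (by simp [m, h1]; omega))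
    have h4 : χ m * χ j' * (χ m - χ j') = 0 := by
      linear_combination h3
    rcases mul_eq_zero.1 h4 with h5 | h5
    · exact absurd h5 (mul_ne_zero (hne _ hmB) (hne _ hj'))
    · exact sub_eq_zero.1 h5

lemma chi_eq' {q : k} (hq : q ≠ 0) {B : Set (Fin N)} {χ : Fin N → k} (h : IsOneDimRep k N q B χ)
    {j j' : Fin N} (hj : j ∈ B) (hj' : j' ∈ B)
    (hb : blk B j.castSucc = blk B j'.castSucc) : χ j = χ j' := by
  rcases le_total j j' with h1 | h1
  · exact chi_eq hq h (j'.val - j.val) j j' (by rw [Fin.le_def] at h1; omega) hj hj' hb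
  · exact (chi_eq hq h (j.val - j'.val) j' j (by rw [Fin.le_def] at h1; omega) hj' hj hb.symm).symm

/-- Basis vectors of the induced module. -/
def eI {B : Set (Fin N)} (d : Dset N B) : IndM k N B := (Finsupp.single d 1 : Dset N B →₀ k)

lemma indT_eI (q : k) (B : Set (Fin N)) (χ : Fin N → k) (i : Fin N) (d : Dset N B) :
    indT k N q B χ i (eI d) = indAct k N q B χ i d := by
  show (Finsupp.lift (IndM k N B) k (Dset N B)) (indAct k N q B χ i) (Finsupp.single d 1) = _
  simp

lemma indAct_eq (q : k) (B : Set (Fin N)) (χ : Fin N → k) (i : Fin N) (d : Dset N B)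
    (h : ∃ j, j ∈ B ∧ d.1⁻¹ * tau N i * d.1 = tau N j) :
    indAct k N q B χ i d = χ h.choose • eI d := dif_pos h

/-- The representative `τ_i d`. -/
def tD {B : Set (Fin N)} (i : Fin N) (d : Dset N B) (h : IsDistL N B (tau N i * d.1)) : Dset N B :=
  ⟨tau N i * d.1, h⟩

lemma indAct_lt (q : k) (B : Set (Fin N)) (χ : Fin N → k) (i : Fin N) (d : Dset N B)
    (h : ¬ ∃ j, j ∈ B ∧ d.1⁻¹ * tau N i * d.1 = tau N j)
    (h2 : IsDistL N B (tau N i * d.1)) (h3 : len N d.1 < len N (tau N i * d.1)) :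
    indAct k N q B χ i d = eI (tD i d h2) :=
  (dif_neg h).trans ((dif_pos h2).trans (if_pos h3))

lemma indAct_gt (q : k) (B : Set (Fin N)) (χ : Fin N → k) (i : Fin N) (d : Dset N B)
    (h : ¬ ∃ j, j ∈ B ∧ d.1⁻¹ * tau N i * d.1 = tau N j)
    (h2 : IsDistL N B (tau N i * d.1)) (h3 : ¬ len N d.1 < len N (tau N i * d.1)) :
    indAct k N q B χ i d = (q - 1) • eI d + q • eI (tD i d h2) :=
  (dif_neg h).trans ((dif_pos h2).trans (if_neg h3))

instance (B : Set (Fin N)) : Finite (Dset N B) :=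
  inferInstanceAs (Finite {σ : Equiv.Perm (Fin (N + 1)) // IsDistL N B σ})

lemma indM_ext {B : Set (Fin N)} {Y : Type} [AddCommGroup Y] [Module k Y]
    {α β : IndM k N B →ₗ[k] Y} (h : ∀ d : Dset N B, α (eI d) = β (eI d)) : α = β := by
  have : ∀ (α β : (Dset N B →₀ k) →ₗ[k] Y),
      (∀ d, α (Finsupp.single d 1) = β (Finsupp.single d 1)) → α = β := by
    intro α β h
    ext d
    simpa using h d
  exact this α β h

variable {r : ℕ} {Bs : Fin r → Set (Fin N)} {χs : Fin r → (Fin N → k)}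

lemma pi_ind_ext {Y : Type} [AddCommGroup Y] [Module k Y]
    {α β : ((t : Fin r) → IndM k N (Bs t)) →ₗ[k] Y}
    (h : ∀ t (d : Dset N (Bs t)), α (Pi.single t (eI d)) = β (Pi.single t (eI d))) : α = β := by
  apply LinearMap.pi_ext'
  intro t
  exact indM_ext fun d => h t d

lemma piIndT_single (q : k) (i : Fin N) (t : Fin r) (x : IndM k N (Bs t)) :
    piIndT k N q Bs χs i (Pi.single t x) = Pi.single t (indT k N q (Bs t) (χs t) i x) := by
  ext1 s
  show indT k N q (Bs s) (χs s) i ((Pi.single t x : (t : Fin r) → IndM k N (Bs t)) s) = _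
  by_cases h : s = t
  · subst h; simp
  · simp [h]

variable {A : Type} [LinearOrder A] [Fintype A]

/-- The word of a distinguished representative. -/
def wdI (g : Fin r → Fin (N + 1) → A) (t : Fin r) (d : Dset N (Bs t)) : Wd N A :=
  fun a => g t (blk (Bs t) (d.1⁻¹ a))

/-- embedding of the induced modules in the word module. -/
def ioI (Bs : Fin r → Set (Fin N)) (g : Fin r → Fin (N + 1) → A) :
    ((t : Fin r) → IndM k N (Bs t)) →ₗ[k] (Wd N A → k) :=
  ∑ t, (Finsupp.lift (Wd N A → k) k (Dset N (Bs t)) fun d => Pi.single (wdI g t d) 1 :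
    (Dset N (Bs t) →₀ k) →ₗ[k] (Wd N A → k)) ∘ₗ
    (LinearMap.proj t : ((t : Fin r) → IndM k N (Bs t)) →ₗ[k] IndM k N (Bs t))

/-- The projection. -/
def prI (Bs : Fin r → Set (Fin N)) (g : Fin r → Fin (N + 1) → A) :
    (Wd N A → k) →ₗ[k] ((t : Fin r) → IndM k N (Bs t)) :=
  LinearMap.pi fun t =>
    ((Finsupp.linearEquivFunOnFinite k k (Dset N (Bs t))).symm.toLinearMap ∘ₗ
      LinearMap.funLeft k k (wdI g t) : (Wd N A → k) →ₗ[k] (Dset N (Bs t) →₀ k))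

lemma ioI_single (g : Fin r → Fin (N + 1) → A) (t : Fin r) (d : Dset N (Bs t)) :
    ioI (k := k) Bs g (Pi.single t (eI d)) = Pi.single (wdI g t d) 1 := by
  rw [ioI, LinearMap.sum_apply, Finset.sum_eq_single t]
  · show (Finsupp.lift (Wd N A → k) k (Dset N (Bs t)) fun d => Pi.single (wdI g t d) 1)
      ((Pi.single t (eI d) : (t : Fin r) → IndM k N (Bs t)) t) = _
    rw [Pi.single_eq_same]
    show (Finsupp.lift (Wd N A → k) k (Dset N (Bs t)) fun d => Pi.single (wdI g t d) 1)
      (Finsupp.single d 1) = _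
    simp
  · intro s _ hs
    show (Finsupp.lift (Wd N A → k) k (Dset N (Bs s)) fun d => Pi.single (wdI g s d) 1)
      ((Pi.single t (eI d) : (t : Fin r) → IndM k N (Bs t)) s) = _
    rw [Pi.single_eq_of_ne hs]
    exact map_zero _
  · simp

lemma prI_apply (g : Fin r → Fin (N + 1) → A) (x : Wd N A → k) (t : Fin r) (d : Dset N (Bs t)) :
    (show Dset N (Bs t) →₀ k from prI Bs g x t) d = x (wdI g t d) := rfl

lemma prI_eq_zero (g : Fin r → Fin (N + 1) → A) (u : Wd N A)
    (h : ∀ t (d : Dset N (Bs t)), wdI g t d ≠ u) : prI (k := k) Bs g (Pi.single u 1) = 0 := by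
  ext1 t
  refine (Finsupp.ext fun d => ?_ : (show Dset N (Bs t) →₀ k from prI Bs g (Pi.single u 1) t) = 0)
  rw [prI_apply, Pi.single_eq_of_ne (h t d)]; rfl

lemma wdI_inj {g : Fin r → Fin (N + 1) → A}
    (hg : ∀ t t' b b', g t b = g t' b' → t = t' ∧ b = b') {t t' : Fin r} {d : Dset N (Bs t)}
    {d' : Dset N (Bs t')} (h : wdI g t d = wdI g t' d') :
    (⟨t, d⟩ : Σ t, Dset N (Bs t)) = ⟨t', d'⟩ := by
  obtain rfl : t = t' := (hg _ _ _ _ (congrFun h 0)).1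
  have : d = d' := Subtype.ext (dist_unique d.2 d'.2 fun x => (hg _ _ _ _ (congrFun h x)).2)
  rw [this]

lemma prI_single {g : Fin r → Fin (N + 1) → A}
    (hg : ∀ t t' b b', g t b = g t' b' → t = t' ∧ b = b') (t : Fin r) (d : Dset N (Bs t)) :
    prI (k := k) Bs g (Pi.single (wdI g t d) 1) = Pi.single t (eI d) := by
  ext1 s
  refine (Finsupp.ext fun d' => ?_ :
    (show Dset N (Bs s) →₀ k from prI Bs g (Pi.single (wdI g t d) 1) s) = 
      (show Dset N (Bs s) →₀ k from (Pi.single t (eI d) : (t : Fin r) → IndM k N (Bs t)) s))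
  rw [prI_apply]
  by_cases h : s = t
  · subst h
    rw [Pi.single_eq_same]
    show _ = (Finsupp.single d 1 : Dset N (Bs s) →₀ k) d'
    by_cases h1 : d' = d
    · subst h1; simp
    · rw [Pi.single_eq_of_ne, Finsupp.single_eq_of_ne h1]
      intro h2
      have := wdI_inj hg h2
      simp at this
      exact h1 this
  · rw [Pi.single_eq_of_ne, Pi.single_eq_of_ne h]
    · rfl
    · intro h2
      have := wdI_inj hg h2
      exact h (congrArg Sigma.fst this)

lemma prI_ioI {g : Fin r → Fin (N + 1) → A}
    (hg : ∀ t t' b b', g t b = g t' b' → t = t' ∧ b = b') :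
    prI (k := k) Bs g ∘ₗ ioI Bs g = LinearMap.id := by
  apply pi_ind_ext
  intro t d
  rw [LinearMap.comp_apply, ioI_single, prI_single hg]; rfl

lemma wdI_tau (g : Fin r → Fin (N + 1) → A) (t : Fin r) (d : Dset N (Bs t)) (i : Fin N)
    (h : IsDistL N (Bs t) (tau N i * d.1)) :
    wdI g t (tD i d h) = wdI g t d ∘ tau N i := by
  ext1 a
  simp [wdI, tD, tau_inv]

lemma ioI_itw {q : k} {c : A → k} {g : Fin r → Fin (N + 1) → A}
    (hg : ∀ t t' b b', g t b = g t' b' → t = t' ∧ b = b') (hm : ∀ t, StrictMono (g t))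
    (hc : ∀ t, ∀ j ∈ Bs t, c (g t (blk (Bs t) j.castSucc)) = χs t j) :
    Itw (piIndT k N q Bs χs) (TX q c) (ioI Bs g) := by
  intro i
  apply pi_ind_ext
  intro t d
  rw [LinearMap.comp_apply, LinearMap.comp_apply, piIndT_single, ioI_single, indT_eI]
  have hsm : ∀ (a : k) (x : IndM k N (Bs t)), ioI Bs g (Pi.single t (a • x)) =
      a • ioI Bs g (Pi.single t x) := by
    intro a x; rw [Pi.single_smul, map_smul]
  have hadd : ∀ (x y : IndM k N (Bs t)), ioI Bs g (Pi.single t (x + y)) =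
      ioI Bs g (Pi.single t x) + ioI Bs g (Pi.single t y) := by
    intro a x; rw [Pi.single_add, map_add]
  by_cases h : ∃ j, j ∈ Bs t ∧ d.1⁻¹ * tau N i * d.1 = tau N j
  · have h1 := (conj_tau_iff d.2 i).1 h
    have h1' : wdI g t d i.castSucc = wdI g t d i.succ := congrArg (g t) h1
    have h2 := h.choose_spec
    have h3 : c (wdI g t d i.castSucc) = χs t h.choose := by
      show c (g t (blk (Bs t) (d.1⁻¹ i.castSucc))) = _
      rw [conj_tau_blk h2.1 h2.2, hc t _ h2.1]
    rw [indAct_eq _ _ _ _ _ h, hsm, ioI_single, TX_single_eq q c i _ h1', h3]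
  · have h1 : blk (Bs t) (d.1⁻¹ i.castSucc) ≠ blk (Bs t) (d.1⁻¹ i.succ) :=
      fun h1 => h ((conj_tau_iff d.2 i).2 h1)
    have h2 := dist_tau_mul d.2 i h1
    by_cases h3 : len N d.1 < len N (tau N i * d.1)
    · rw [indAct_lt _ _ _ _ _ h h2 h3, ioI_single, wdI_tau, TX_single_lt]
      rw [len_lt_iff] at h3
      exact hm t (lt_of_le_of_ne (blk_mono _ h3.le) h1)
    · rw [indAct_gt _ _ _ _ _ h h2 h3, hadd, hsm, hsm, ioI_single, ioI_single, wdI_tau,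
        TX_single_gt]
      rw [len_lt_iff] at h3
      exact hm t (lt_of_le_of_ne (blk_mono _ (not_lt.1 h3)) h1.symm)

lemma prI_itw {q : k} {c : A → k} {g : Fin r → Fin (N + 1) → A}
    (hg : ∀ t t' b b', g t b = g t' b' → t = t' ∧ b = b') (hm : ∀ t, StrictMono (g t))
    (hc : ∀ t, ∀ j ∈ Bs t, c (g t (blk (Bs t) j.castSucc)) = χs t j) :
    Itw (TX q c) (piIndT k N q Bs χs) (prI Bs g) := by
  intro i
  apply single_ext
  intro u
  rw [LinearMap.comp_apply, LinearMap.comp_apply]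
  by_cases h : ∃ t, ∃ d : Dset N (Bs t), wdI g t d = u
  · obtain ⟨t, d, rfl⟩ := h
    rw [← ioI_single, ← (ioI_itw hg hm hc).apply]
    have h1 := fun x => LinearMap.congr_fun (prI_ioI (k := k) (Bs := Bs) hg) x
    simp only [LinearMap.comp_apply, LinearMap.id_apply] at h1
    rw [h1, h1]
  · push Not at h
    rw [prI_eq_zero g u h, map_zero]
    have h' : u i.castSucc ≠ u i.succ → ∀ t (d : Dset N (Bs t)), wdI g t d ≠ u ∘ tau N i := by
      intro hu t d hd
      have h1 : wdI g t d i.castSucc ≠ wdI g t d i.succ := by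
        rw [hd]; simpa [tau_castSucc, tau_succ] using hu.symm
      have h2 := dist_tau_mul d.2 i fun h2 => h1 (congrArg (g t) h2)
      apply h t (tD i d h2)
      rw [wdI_tau, hd, comp_tau_comp_tau]
    rcases lt_trichotomy (u i.castSucc) (u i.succ) with h1 | h1 | h1
    · rw [TX_single_lt _ _ _ _ h1, prI_eq_zero g _ (h' h1.ne)]
    · rw [TX_single_eq _ _ _ _ h1, map_smul, prI_eq_zero g u h, smul_zero]
    · rw [TX_single_gt _ _ _ _ h1, map_add, map_smul, map_smul, prI_eq_zero g u h,
        prI_eq_zero g _ (h' h1.ne'), smul_zero, smul_zero, add_zero]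

/-- Data exhibiting a module as a summand. -/
lemma interTw_finrank {M M' X : Type} [AddCommGroup M] [Module k M] [AddCommGroup M'] [Module k M']
    [AddCommGroup X] [Module k X]
    {T : Fin N → Module.End k M} {S : Fin N → Module.End k M'} {U : Fin N → Module.End k X}
    {a : M →ₗ[k] X} {p : X →ₗ[k] M} {a' : M' →ₗ[k] X} {p' : X →ₗ[k] M'}
    (ha : Itw T U a) (hp : Itw U T p) (hpa : p ∘ₗ a = LinearMap.id)
    (ha' : Itw S U a') (hp' : Itw U S p') (hpa' : p' ∘ₗ a' = LinearMap.id) :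
    Module.finrank k (interTw k N T S) = Module.finrank k (cut U (a ∘ₗ p) (a' ∘ₗ p')) := by
  have e1 : ∀ x, p (a x) = x := fun x => LinearMap.congr_fun hpa x
  have e2 : ∀ x, p' (a' x) = x := fun x => LinearMap.congr_fun hpa' x
  refine LinearEquiv.finrank_eq (LinearEquiv.ofLinearMap
    (LinearMap.codRestrict _ ((LinearMap.compRight k a' ∘ₗ LinearMap.lcomp k M' p) ∘ₗ
      (interTw k N T S).subtype) ?_)
    (LinearMap.codRestrict _ ((LinearMap.compRight k p' ∘ₗ LinearMap.lcomp k X a) ∘ₗ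
      (cut U (a ∘ₗ p) (a' ∘ₗ p')).subtype) ?_) ?_ ?_)
  · rintro ⟨φ, hφ⟩
    have hφ' : Itw T S φ := hφ
    refine ⟨(hp.comp hφ').comp ha', ?_, ?_⟩
    · ext x; simp [e2]
    · ext x; simp [e1]
  · rintro ⟨φ, hφ, -, -⟩
    exact (ha.comp hφ).comp hp'
  · ext1 ⟨φ, hφ, h1, h2⟩
    apply Subtype.ext
    refine LinearMap.ext fun x => ?_
    have h3 := LinearMap.congr_fun h2 x
    have h4 := LinearMap.congr_fun h1 (φ x)
    have h5 := LinearMap.congr_fun h1 x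
    simp at h3 h4 h5 ⊢
    rw [h3, h5]
  · ext1 ⟨φ, hφ⟩
    apply Subtype.ext
    refine LinearMap.ext fun x => ?_
    simp [e1, e2]

lemma exists_summand {q : k} {c : A → k} {g : Fin r → Fin (N + 1) → A}
    (hg : ∀ t t' b b', g t b = g t' b' → t = t' ∧ b = b') (hm : ∀ t, StrictMono (g t))
    (hc : ∀ t, ∀ j ∈ Bs t, c (g t (blk (Bs t) j.castSucc)) = χs t j)
    {M : Type} [AddCommGroup M] [Module k M] {T : Fin N → Module.End k M}
    {ι : M →ₗ[k] ((t : Fin r) → IndM k N (Bs t))} {π : ((t : Fin r) → IndM k N (Bs t)) →ₗ[k] M}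
    (h1 : Itw T (piIndT k N q Bs χs) ι) (h2 : Itw (piIndT k N q Bs χs) T π)
    (h3 : π ∘ₗ ι = LinearMap.id) :
    ∃ (a : M →ₗ[k] (Wd N A → k)) (p : (Wd N A → k) →ₗ[k] M),
      Itw T (TX q c) a ∧ Itw (TX q c) T p ∧ p ∘ₗ a = LinearMap.id := by
  refine ⟨ioI Bs g ∘ₗ ι, π ∘ₗ prI Bs g, h1.comp (ioI_itw hg hm hc), (prI_itw hg hm hc).comp h2, ?_⟩
  rw [LinearMap.comp_assoc, ← LinearMap.comp_assoc ι, prI_ioI hg, LinearMap.id_comp, h3]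

/-- The colour of a letter. -/
def colI (q : k) {s : ℕ} (Bs : Fin s → Set (Fin N)) (χs : Fin s → (Fin N → k))
    (x : Lex (Fin s × Fin (N + 1))) : k :=
  if h : ∃ j, j ∈ Bs (ofLex x).1 ∧ blk (Bs (ofLex x).1) j.castSucc = (ofLex x).2 then
    χs (ofLex x).1 h.choose else q

lemma colI_eq {q : k} (hq : q ≠ 0) {s : ℕ} {Bs : Fin s → Set (Fin N)} {χs : Fin s → (Fin N → k)}
    (h : ∀ t, IsOneDimRep k N q (Bs t) (χs t)) (t : Fin s) (j : Fin N) (hj : j ∈ Bs t) :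
    colI q Bs χs (toLex (t, blk (Bs t) j.castSucc)) = χs t j := by
  have h0 : ∃ j', j' ∈ Bs t ∧ blk (Bs t) j'.castSucc = blk (Bs t) j.castSucc := ⟨j, hj, rfl⟩
  show (if h : ∃ j', j' ∈ Bs t ∧ blk (Bs t) j'.castSucc = blk (Bs t) j.castSucc then
    χs t h.choose else q) = _
  rw [dif_pos h0]
  exact chi_eq' hq (h t) h0.choose_spec.1 hj h0.choose_spec.2

lemma colI_quad {q : k} {s : ℕ} {Bs : Fin s → Set (Fin N)} {χs : Fin s → (Fin N → k)}
    (h : ∀ t, IsOneDimRep k N q (Bs t) (χs t)) (x : Lex (Fin s × Fin (N + 1))) :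
    (colI q Bs χs x - q) * (colI q Bs χs x + 1) = 0 := by
  unfold colI
  split_ifs with h0
  · exact (h _).1 _ h0.choose_spec.1
  · simp

end Embed

section Final

variable {N} {k}

instance lexFT (s : ℕ) : Fintype (Lex (Fin s × Fin (N + 1))) :=
  inferInstanceAs (Fintype (Fin s × Fin (N + 1)))

lemma final_aux {M M' : Type}
    [AddCommGroup M] [Module k M] [AddCommGroup M'] [Module k M']
    (q : k) (hq : q ≠ 0)
    (T : Fin N → Module.End k M) (S : Fin N → Module.End k M')
    (hTs : HasOneDimSources k N q T) (hSs : HasOneDimSources k N q S) :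
    Module.finrank k ↥(interTw k N S T) = Module.finrank k ↥(interTw k N T S) := by
  obtain ⟨r, Bs, χs, hr, ι, π, h1, h2, h3⟩ := hTs
  obtain ⟨r', Bs', χs', hr', ι', π', h1', h2', h3'⟩ := hSs
  let Bb : Fin (r + r') → Set (Fin N) := Fin.append Bs Bs'
  let χb : Fin (r + r') → (Fin N → k) := Fin.append χs χs'
  have hb : ∀ t, IsOneDimRep k N q (Bb t) (χb t) := by
    intro t
    induction t using Fin.addCases with
    | left t => simpa [Bb, χb] using hr t
    | right t => simpa [Bb, χb] using hr' t
  let c := colI q Bb χb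
  have hmono : ∀ t : Fin (r + r'), StrictMono fun b : Fin (N + 1) =>
      (toLex (t, b) : Lex (Fin (r + r') × Fin (N + 1))) := by
    intro t b b' h
    exact (Prod.Lex.toLex_lt_toLex).2 (Or.inr ⟨rfl, h⟩)
  obtain ⟨a, p, ha, hp, hpa⟩ := exists_summand (c := c)
    (g := fun t b => (toLex (Fin.castAdd r' t, b) : Lex (Fin (r + r') × Fin (N + 1))))
    (by
      intro t t' b b' h
      have h' := toLex.injective h
      rw [Prod.mk.injEq] at h'
      exact ⟨Fin.castAdd_injective _ _ h'.1, h'.2⟩)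
    (fun t => hmono _)
    (by
      intro t j hj
      have := colI_eq hq hb (Fin.castAdd r' t) j (by simpa [Bb] using hj)
      simpa [Bb, χb] using this) h1 h2 h3
  obtain ⟨a', p', ha', hp', hpa'⟩ := exists_summand (c := c)
    (g := fun t b => (toLex (Fin.natAdd r t, b) : Lex (Fin (r + r') × Fin (N + 1))))
    (by
      intro t t' b b' h
      have h' := toLex.injective h
      rw [Prod.mk.injEq] at h'
      exact ⟨Fin.natAdd_injective _ _ h'.1, h'.2⟩)
    (fun t => hmono _)
    (by
      intro t j hj
      have := colI_eq hq hb (Fin.natAdd r t) j (by simpa [Bb] using hj)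
      simpa [Bb, χb] using this) h1' h2' h3'
  rw [interTw_finrank ha hp hpa ha' hp' hpa', interTw_finrank ha' hp' hpa' ha hp hpa]
  have idem : ∀ {Z : Type} [AddCommGroup Z] [Module k Z]
      {a : Z →ₗ[k] (Wd N (Lex (Fin (r + r') × Fin (N + 1))) → k)} {p},
      p ∘ₗ a = LinearMap.id → (a ∘ₗ p) * (a ∘ₗ p) = a ∘ₗ p := by
    intro Z _ _ a p h
    refine LinearMap.ext fun x => ?_
    show a (p (a (p x))) = a (p x)
    rw [show p (a (p x)) = p x from LinearMap.congr_fun h (p x)]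
  exact cut_symm hq (colI_quad hb) (hp'.comp ha') (idem hpa') (hp.comp ha) (idem hpa)

end Final

/-- for `q ≠ 0` and finite dimensional `H_n(q)`-modules `M`, `N`
all of whose indecomposable direct summands have one-dimensional sources,
`dim Hom_{H_n(q)}(N, M) = dim Hom_{H_n(q)}(M, N)`. -/
theorem dim_hom_symmetric {M M' : Type}
    [AddCommGroup M] [Module k M] [FiniteDimensional k M]
    [AddCommGroup M'] [Module k M'] [FiniteDimensional k M']
    (q : k) (hq : q ≠ 0)
    (T : Fin N → Module.End k M) (S : Fin N → Module.End k M')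
    (hT : IsHeckeRep k N q T) (hS : IsHeckeRep k N q S)
    (hTs : HasOneDimSources k N q T) (hSs : HasOneDimSources k N q S) :
    Module.finrank k ↥(interTw k N S T) = Module.finrank k ↥(interTw k N T S) := by
  exact final_aux q hq T S hTs hSs

end
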